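/- arXiv:1710.09507 — 4 statements merged into one kernel-verified Lean document; each statement's English description precedes it below -/
import Mathlib

section
/- The winding map P ↦ (w₁,…,w_n) is injective on the set of decorated ordered set partitions of type (a,n) with 1 ∈ L₁: if two decorated ordered set partitions of type (a,n), each having 1 in its first block, have equal winding vectors (w₁,…,w_n), then they are equal. -/
/-- `P` is a decorated ordered set partition of `{1,…,n}` (encoded as `Fin n`)
with positive decorations summing to `a`: its blocks (the first components)
are pairwise disjoint nonempty subsets of `Fin n` covering all of `Fin n`, and
its decorations (the second components) are positive integers summing to `a`. -/
def IsDOSP (n a : ℕ) (P : List (Finset (Fin n) × ℕ)) : Prop :=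
  (∀ B ∈ P, B.1.Nonempty ∧ 1 ≤ B.2) ∧
  List.Pairwise (fun B C => Disjoint B.1 C.1) P ∧
  (∀ x : Fin n, ∃ B ∈ P, x ∈ B.1) ∧
  (P.map Prod.snd).sum = a

/-- The element `1` of `{1,…,n}` (encoded as `0 : Fin n`) lies in the first block of `P`. -/
def FirstBlock {n : ℕ} (P : List (Finset (Fin n) × ℕ)) : Prop :=
  ∀ x : Fin n, (x : ℕ) = 0 → x ∈ P.headI.1

/-- The position `p_x` of `x`: the sum of the decorations of the blocks strictly
before the (first) block containing `x`. -/
def posOf {n : ℕ} (P : List (Finset (Fin n) × ℕ)) (x : Fin n) : ℕ :=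
  ((P.takeWhile (fun B => decide (x ∉ B.1))).map Prod.snd).sum

/-- The cyclic successor on `Fin n` (`n` maps back to `1`). -/
def cyc {n : ℕ} (i : Fin n) : Fin n := ⟨((i : ℕ) + 1) % n, Nat.mod_lt _ i.pos⟩

/-- The winding-vector entry `w_i ∈ {0,…,a−1}`: the representative of
`p_{i+1} − p_i` modulo `a` for `i = 1,…,n−1`, and of `p_1 − p_n` for `i = n`. -/
def wind {n : ℕ} (a : ℕ) (P : List (Finset (Fin n) × ℕ)) (i : Fin n) : ℕ :=
  (((posOf P (cyc i) : ℤ) - (posOf P i : ℤ)) % (a : ℤ)).toNat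

/-- The level `w₁ + ⋯ + w_n` of `P`. -/
def level {n : ℕ} (a : ℕ) (P : List (Finset (Fin n) × ℕ)) : ℕ :=
  ∑ i : Fin n, wind a P i

lemma posOf_cons_of_mem {n : ℕ} {B : Finset (Fin n) × ℕ} (P : List (Finset (Fin n) × ℕ))
    {x : Fin n} (hx : x ∈ B.1) : posOf (B :: P) x = 0 := by
  simp [posOf, hx]

lemma posOf_cons_of_notMem {n : ℕ} {B : Finset (Fin n) × ℕ} (P : List (Finset (Fin n) × ℕ))
    {x : Fin n} (hx : x ∉ B.1) : posOf (B :: P) x = B.2 + posOf P x := by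
  simp [posOf, hx]

lemma posOf_lt_sum {n : ℕ} {P : List (Finset (Fin n) × ℕ)} (hpos : ∀ B ∈ P, 1 ≤ B.2)
    {x : Fin n} (hx : ∃ B ∈ P, x ∈ B.1) : posOf P x < (P.map Prod.snd).sum := by
  induction P with
  | nil => simp at hx
  | cons B P ih =>
    have hB := hpos B (by simp)
    by_cases hxB : x ∈ B.1
    · rw [posOf_cons_of_mem P hxB, List.map_cons, List.sum_cons]
      omega
    · rw [posOf_cons_of_notMem P hxB, List.map_cons, List.sum_cons]
      have := ih (fun C hC => hpos C (by simp [hC])) (by simpa [hxB] using hx)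
      omega

lemma posOf_eq_zero_of_firstBlock {n : ℕ} {P : List (Finset (Fin n) × ℕ)}
    (h : FirstBlock P) {x : Fin n} (hx : (x : ℕ) = 0) : posOf P x = 0 := by
  cases P with
  | nil => rfl
  | cons B P => exact posOf_cons_of_mem P (h x hx)

lemma mem_head_of_posOf_eq {n : ℕ} {B C : Finset (Fin n) × ℕ}
    {P Q : List (Finset (Fin n) × ℕ)} (hC : 1 ≤ C.2) {x : Fin n}
    (h : posOf (B :: P) x = posOf (C :: Q) x) (hx : x ∈ B.1) : x ∈ C.1 := by
  by_contra hxC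
  rw [posOf_cons_of_mem P hx, posOf_cons_of_notMem Q hxC] at h
  omega

lemma decoration_head_le {n : ℕ} {B C D : Finset (Fin n) × ℕ}
    {P Q : List (Finset (Fin n) × ℕ)} (hD : D.1.Nonempty) (hBD : Disjoint B.1 D.1)
    (hBC : B.1 = C.1)
    (h : ∀ x ∈ D.1, posOf (B :: D :: P) x = posOf (C :: Q) x) : C.2 ≤ B.2 := by
  obtain ⟨x, hx⟩ := hD
  have hxB : x ∉ B.1 := Finset.disjoint_right.mp hBD hx
  have := h x hx
  rw [posOf_cons_of_notMem _ hxB, posOf_cons_of_mem _ hx,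
    posOf_cons_of_notMem _ (hBC ▸ hxB)] at this
  omega

/-- An ordered list of disjoint nonempty decorated blocks is determined by its support,
its total decoration and the positions of its elements. -/
lemma eq_of_posOf_eq {n : ℕ} {P Q : List (Finset (Fin n) × ℕ)}
    (hP : ∀ B ∈ P, B.1.Nonempty ∧ 1 ≤ B.2) (hQ : ∀ B ∈ Q, B.1.Nonempty ∧ 1 ≤ B.2)
    (hPd : P.Pairwise (fun B C => Disjoint B.1 C.1))
    (hQd : Q.Pairwise (fun B C => Disjoint B.1 C.1))
    (hsupp : ∀ x, (∃ B ∈ P, x ∈ B.1) ↔ ∃ B ∈ Q, x ∈ B.1)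
    (hsum : (P.map Prod.snd).sum = (Q.map Prod.snd).sum)
    (hpos : ∀ x, (∃ B ∈ P, x ∈ B.1) → posOf P x = posOf Q x) : P = Q := by
  induction P generalizing Q with
  | nil =>
    cases Q with
    | nil => rfl
    | cons C Q =>
      obtain ⟨x, hx⟩ := (hQ C (by simp)).1
      simpa using (hsupp x).mpr ⟨C, by simp, hx⟩
  | cons B P ih =>
    cases Q with
    | nil =>
      obtain ⟨x, hx⟩ := (hP B (by simp)).1
      simpa using (hsupp x).mp ⟨B, by simp, hx⟩
    | cons C Q =>
      have hfst : B.1 = C.1 := by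
        ext x
        refine ⟨fun hx => ?_, fun hx => ?_⟩
        · exact mem_head_of_posOf_eq (hQ C (by simp)).2 (hpos x ⟨B, by simp, hx⟩) hx
        · exact mem_head_of_posOf_eq (hP B (by simp)).2
            (hpos x ((hsupp x).mpr ⟨C, by simp, hx⟩)).symm hx
      rw [List.pairwise_cons] at hPd hQd
      have hPB : ∀ x, (∃ D ∈ P, x ∈ D.1) → x ∉ B.1 := fun x ⟨D, hD, hx⟩ =>
        Finset.disjoint_right.mp (hPd.1 D hD) hx
      have hQB : ∀ x, (∃ D ∈ Q, x ∈ D.1) → x ∉ B.1 := fun x ⟨D, hD, hx⟩ =>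
        hfst ▸ Finset.disjoint_right.mp (hQd.1 D hD) hx
      have htail : ∀ x, (∃ D ∈ P, x ∈ D.1) ↔ ∃ D ∈ Q, x ∈ D.1 := by
        intro x
        have hx := hsupp x
        simp only [List.exists_mem_cons_iff, ← hfst] at hx
        exact ⟨fun h => (hx.mp (.inr h)).resolve_left (hPB x h),
          fun h => (hx.mpr (.inr h)).resolve_left (hQB x h)⟩
      have hsnd : B.2 = C.2 := by
        cases P with
        | nil =>
          cases Q with
          | nil => simpa using hsum
          | cons E Q =>
            obtain ⟨x, hx⟩ := (hQ E (by simp)).1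
            simpa using (htail x).mpr ⟨E, by simp, hx⟩
        | cons D P =>
          cases Q with
          | nil =>
            obtain ⟨x, hx⟩ := (hP D (by simp)).1
            simpa using (htail x).mp ⟨D, by simp, hx⟩
          | cons E Q =>
            apply le_antisymm
            · exact decoration_head_le (hQ E (by simp)).1 (hQd.1 E (by simp)) hfst.symm
                fun x hx => (hpos x ((hsupp x).mpr ⟨E, by simp, hx⟩)).symm
            · exact decoration_head_le (hP D (by simp)).1 (hPd.1 D (by simp)) hfst
                fun x hx => hpos x ⟨D, by simp, hx⟩
      obtain rfl : B = C := Prod.ext hfst hsnd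
      congr 1
      refine ih (fun D hD => hP D (by simp [hD])) (fun D hD => hQ D (by simp [hD]))
        hPd.2 hQd.2 htail (by simpa using hsum) fun x hx => ?_
      obtain ⟨D, hD, hxD⟩ := hx
      have hxB := hPB x ⟨D, hD, hxD⟩
      have := hpos x ⟨D, by simp [hD], hxD⟩
      rw [posOf_cons_of_notMem P hxB, posOf_cons_of_notMem Q hxB] at this
      omega

lemma posOf_cyc_eq_of_wind_eq {n a : ℕ} (ha : 1 ≤ a) {P Q : List (Finset (Fin n) × ℕ)}
    (hP : IsDOSP n a P) (hQ : IsDOSP n a Q) {i : Fin n}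
    (hw : wind a P i = wind a Q i) (hi : posOf P i = posOf Q i) :
    posOf P (cyc i) = posOf Q (cyc i) := by
  have hp : posOf P (cyc i) < a :=
    (posOf_lt_sum (fun B hB => (hP.1 B hB).2) (hP.2.2.1 _)).trans_eq hP.2.2.2
  have hq : posOf Q (cyc i) < a :=
    (posOf_lt_sum (fun B hB => (hQ.1 B hB).2) (hQ.2.2.1 _)).trans_eq hQ.2.2.2
  have ha' : (a : ℤ) ≠ 0 := by omega
  unfold wind at hw
  rw [hi] at hw
  have hmod : (posOf P (cyc i) : ℤ) - posOf Q i ≡ posOf Q (cyc i) - posOf Q i [ZMOD a] := by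
    have h₁ := Int.emod_nonneg ((posOf P (cyc i) : ℤ) - posOf Q i) ha'
    have h₂ := Int.emod_nonneg ((posOf Q (cyc i) : ℤ) - posOf Q i) ha'
    unfold Int.ModEq
    omega
  have := Int.natCast_modEq_iff.mp (by simpa using hmod.add_right (posOf Q i : ℤ))
  exact Nat.ModEq.eq_of_lt_of_lt this hp hq

/-- the winding map `P ↦ (w₁,…,w_n)` is injective on decorated
ordered set partitions of type `(a,n)` with `1` in the first block. -/
theorem winding_map_injective (n a : ℕ) (hn : 1 ≤ n) (ha : 1 ≤ a)
    (P Q : List (Finset (Fin n) × ℕ))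
    (hP : IsDOSP n a P) (hQ : IsDOSP n a Q)
    (h1P : FirstBlock P) (h1Q : FirstBlock Q)
    (hw : ∀ i : Fin n, wind a P i = wind a Q i) :
    P = Q := by
  have hpos : ∀ (k : ℕ) (hk : k < n), posOf P ⟨k, hk⟩ = posOf Q ⟨k, hk⟩ := by
    intro k
    induction k with
    | zero =>
      intro hk
      rw [posOf_eq_zero_of_firstBlock h1P rfl, posOf_eq_zero_of_firstBlock h1Q rfl]
    | succ k ih =>
      intro hk
      have hcyc : cyc (⟨k, by omega⟩ : Fin n) = ⟨k + 1, hk⟩ :=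
        Fin.ext (Nat.mod_eq_of_lt hk)
      rw [← hcyc]
      exact posOf_cyc_eq_of_wind_eq ha hP hQ (hw _) (ih _)
  exact eq_of_posOf_eq hP.1 hQ.1 hP.2.1 hQ.2.1
    (fun x => iff_of_true (hP.2.2.1 x) (hQ.2.2.1 x)) (hP.2.2.2.trans hQ.2.2.2.symm)
    fun x _ => hpos x x.isLt
end

section
/- For integers 1 ≤ a < n, the number of hypersimplicial ordered set partitions of type (a,n) with 1 ∈ L₁ equals the Eulerian number counting permutations of {1,…,n−1} with exactly a−1 descents. -/
/-- The descent set of a permutation `σ` of `Fin m` (encoding `{1,…,m}`):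
positions `i ∈ {1,…,m−1}` with `σ(i) > σ(i+1)`. -/
def descentSet {m : ℕ} (σ : Equiv.Perm (Fin m)) : Finset (Fin m) :=
  Finset.univ.filter (fun i => (i : ℕ) + 1 < m ∧ σ (cyc i) < σ i)

open Polynomial

theorem card_descentSet_eq_sum {m : ℕ} (σ : Equiv.Perm (Fin (m + 1))) :
    (descentSet σ).card = ∑ i : Fin m, if σ i.succ < σ i.castSucc then 1 else 0 := by
  have hcyc : ∀ i : Fin m, cyc i.castSucc = i.succ := by
    intro i
    apply Fin.ext
    simp only [cyc, Fin.val_castSucc, Fin.val_succ]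
    exact Nat.mod_eq_of_lt (by omega)
  rw [descentSet, Finset.card_filter, Fin.sum_univ_castSucc]
  simp [hcyc]

/-- The permutation of `Fin (m + 1)` with first value `p` whose remaining values are ordered
as those of `τ`. -/
noncomputable def consPerm {m : ℕ} (x : Fin (m + 1) × Equiv.Perm (Fin m)) :
    Equiv.Perm (Fin (m + 1)) :=
  Equiv.ofBijective (Fin.cons x.1 (fun i => x.1.succAbove (x.2 i))) <| by
    rw [← Finite.injective_iff_bijective, Fin.cons_injective_iff]
    refine ⟨?_, (Fin.succAbove_right_injective).comp x.2.injective⟩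
    rintro ⟨i, hi⟩
    exact Fin.succAbove_ne _ _ hi

@[simp] theorem consPerm_zero {m : ℕ} (x : Fin (m + 1) × Equiv.Perm (Fin m)) :
    consPerm x 0 = x.1 := by simp [consPerm]

@[simp] theorem consPerm_succ {m : ℕ} (x : Fin (m + 1) × Equiv.Perm (Fin m)) (i : Fin m) :
    consPerm x i.succ = x.1.succAbove (x.2 i) := by simp [consPerm]

theorem consPerm_bijective (m : ℕ) : Function.Bijective (consPerm (m := m)) := by
  rw [Fintype.bijective_iff_injective_and_card]
  constructor
  · rintro ⟨p, τ⟩ ⟨q, ρ⟩ h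
    have h0 : p = q := by simpa using congrArg (fun σ => σ 0) h
    subst h0
    refine Prod.ext rfl (Equiv.ext fun i => ?_)
    simpa using congrArg (fun σ => σ i.succ) h
  · simp [Fintype.card_perm, Nat.factorial_succ]

theorem card_descentSet_consPerm {m : ℕ} (p : Fin (m + 2)) (τ : Equiv.Perm (Fin (m + 1))) :
    (descentSet (consPerm (p, τ))).card =
      (if (τ 0).castSucc < p then 1 else 0) + (descentSet τ).card := by
  rw [card_descentSet_eq_sum, card_descentSet_eq_sum, Fin.sum_univ_succ]
  congr 1
  · rw [Fin.castSucc_zero, consPerm_zero, consPerm_succ]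
    simp only [Fin.succAbove_lt_iff_castSucc_lt]
  · refine Finset.sum_congr rfl fun i _ => ?_
    rw [← Fin.succ_castSucc, consPerm_succ, consPerm_succ]
    simp only [Fin.succAbove_lt_succAbove_iff]

/-- The descent polynomial of the permutations of `Fin (m + 1)` with first value `p`. -/
noncomputable def headEulerian (m : ℕ) (p : Fin (m + 1)) : ℚ[X] :=
  ∑ τ : Equiv.Perm (Fin m), X ^ (descentSet (consPerm (p, τ))).card

/-- The Eulerian polynomial: the descent polynomial of the permutations of `Fin m`. -/
noncomputable def eulerianPoly (m : ℕ) : ℚ[X] :=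
  ∑ σ : Equiv.Perm (Fin m), X ^ (descentSet σ).card

theorem eulerianPoly_succ (m : ℕ) : eulerianPoly (m + 1) = ∑ p, headEulerian m p := by
  simp only [eulerianPoly, headEulerian]
  rw [← Fintype.sum_prod_type' (f := fun p τ => (X : ℚ[X]) ^ (descentSet (consPerm (p, τ))).card)]
  exact (Fintype.sum_bijective _ (consPerm_bijective m) _ _ fun _ => rfl).symm

theorem eulerianPoly_zero : eulerianPoly 0 = 1 := by
  simp [eulerianPoly, descentSet]

theorem headEulerian_zero (p : Fin 1) : headEulerian 0 p = 1 := by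
  simp [headEulerian, card_descentSet_eq_sum]

/-- The descent polynomial of the permutations of `Fin m` preceded by a letter exceeding
exactly the `p` smallest letters. -/
noncomputable def prefixedEulerian : ℕ → ℕ → ℚ[X]
  | 0, _ => 1
  | m + 1, p => ∑ j : Fin (m + 1), (if (j : ℕ) < p then X else 1) * headEulerian m j

theorem headEulerian_eq (m : ℕ) (p : Fin (m + 1)) :
    headEulerian m p = prefixedEulerian m p := by
  cases m with
  | zero => simp [headEulerian_zero, prefixedEulerian]
  | succ m =>
    simp only [headEulerian, prefixedEulerian, card_descentSet_consPerm, Finset.mul_sum]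
    rw [← (consPerm_bijective m).sum_comp, Fintype.sum_prod_type]
    refine Finset.sum_congr rfl fun j _ => Finset.sum_congr rfl fun τ _ => ?_
    rw [consPerm_zero, pow_add, pow_ite, pow_one, pow_zero]
    simp only [Fin.lt_def, Fin.val_castSucc]

theorem prefixedEulerian_zero_right (m : ℕ) : prefixedEulerian m 0 = eulerianPoly m := by
  cases m with
  | zero => simp [prefixedEulerian, eulerianPoly_zero]
  | succ m => simp [prefixedEulerian, eulerianPoly_succ]

theorem prefixedEulerian_self (m : ℕ) :
    prefixedEulerian (m + 1) (m + 1) = X * eulerianPoly (m + 1) := by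
  rw [eulerianPoly_succ, prefixedEulerian, Finset.mul_sum]
  refine Finset.sum_congr rfl fun j _ => ?_
  rw [if_pos j.2]

theorem prefixedEulerian_succ_right {m p : ℕ} (hp : p ≤ m) :
    prefixedEulerian (m + 1) (p + 1) =
      prefixedEulerian (m + 1) p + (X - 1) * prefixedEulerian m p := by
  rw [← headEulerian_eq m ⟨p, by omega⟩, prefixedEulerian, prefixedEulerian]
  have hs : (X - 1) * headEulerian m ⟨p, by omega⟩ =
      ∑ j : Fin (m + 1), if j = ⟨p, by omega⟩ then (X - 1) * headEulerian m j else 0 := by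
    simp
  rw [hs, ← Finset.sum_add_distrib]
  refine Finset.sum_congr rfl fun j _ => ?_
  rcases lt_trichotomy (j : ℕ) p with h | h | h
  · simp [h, h.trans (Nat.lt_succ_self p), Fin.ext_iff, h.ne]
  · simp only [Fin.ext_iff, h, lt_irrefl, if_false, if_true, Nat.lt_succ_self]
    ring
  · simp [Fin.ext_iff, h.ne', h.not_gt, Nat.not_lt.2 (Nat.succ_le_of_lt h)]

theorem prefixedEulerian_eq_sum (r i : ℕ) :
    prefixedEulerian (i + r) i = ∑ kl ∈ Finset.HasAntidiagonal.antidiagonal i,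
      (i.choose kl.1 : ℚ[X]) * ((X - 1) ^ kl.1 * eulerianPoly (kl.2 + r)) := by
  induction i generalizing r with
  | zero => simp [prefixedEulerian_zero_right]
  | succ i ih =>
    have h1 := ih (r + 1)
    have h2 : prefixedEulerian (i + 1 + r) (i + 1) = _ :=
      add_right_comm i 1 r ▸ prefixedEulerian_succ_right (Nat.le_add_right i r)
    have h3 := Finset.sum_antidiagonal_choose_succ_mul
      (fun k l => (X - 1 : ℚ[X]) ^ k * eulerianPoly (l + r)) i
    refine h2.trans (Eq.trans ?_ h3.symm)
    rw [← add_assoc, add_right_comm] at h1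
    rw [h1, ih r, Finset.mul_sum]
    refine congrArg₂ (· + ·) (Finset.sum_congr rfl fun kl _ => ?_)
      (Finset.sum_congr rfl fun kl h => ?_)
    · rw [add_right_comm kl.2 1 r, add_assoc kl.2 r 1]
    · rw [Nat.choose_symm_of_eq_add (Finset.HasAntidiagonal.mem_antidiagonal.1 h).symm, pow_succ]
      ring

theorem sum_choose_mul_eulerianPoly (n : ℕ) :
    ∑ kl ∈ Finset.HasAntidiagonal.antidiagonal n,
      (n.choose kl.1 : ℚ[X]) * ((X - 1) ^ kl.1 * eulerianPoly kl.2) =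
      X * eulerianPoly n + if n = 0 then 1 - X else 0 := by
  have h := prefixedEulerian_eq_sum 0 n
  simp only [add_zero] at h
  rw [← h]
  cases n with
  | zero => simp [prefixedEulerian, eulerianPoly_zero]
  | succ n => simp [prefixedEulerian_self]

/-- `P` is an ordered set partition of `s` with decorations `1 ≤ l < |L|` on each block `L`. -/
def IsHypersimplicial {α : Type*} (s : Finset α) (P : List (Finset α × ℕ)) : Prop :=
  (∀ B ∈ P, 1 ≤ B.2 ∧ B.2 < B.1.card) ∧
  P.Pairwise (fun B C => Disjoint B.1 C.1) ∧
  ∀ x, x ∈ s ↔ ∃ B ∈ P, x ∈ B.1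

theorem isHypersimplicial_nil {α : Type*} {s : Finset α} :
    IsHypersimplicial s [] ↔ s = ∅ := by
  simp [IsHypersimplicial, Finset.eq_empty_iff_forall_notMem]

theorem isHypersimplicial_cons {α : Type*} [DecidableEq α] {s : Finset α} {B : Finset α × ℕ}
    {P : List (Finset α × ℕ)} :
    IsHypersimplicial s (B :: P) ↔
      B.1 ⊆ s ∧ (1 ≤ B.2 ∧ B.2 < B.1.card) ∧ IsHypersimplicial (s \ B.1) P := by
  simp only [IsHypersimplicial, List.forall_mem_cons, List.pairwise_cons, List.exists_mem_cons_iff,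
    Finset.mem_sdiff]
  constructor
  · rintro ⟨⟨h1, h2⟩, ⟨h3, h4⟩, h5⟩
    refine ⟨fun x hx => (h5 x).2 (Or.inl hx), h1, h2, h4, fun x => ?_⟩
    rw [h5]
    constructor
    · rintro ⟨h | h, h'⟩
      · exact absurd h h'
      · exact h
    · rintro ⟨C, hC, hx⟩
      exact ⟨Or.inr ⟨C, hC, hx⟩, fun h => Finset.disjoint_left.1 (h3 C hC) h hx⟩
  · rintro ⟨h0, h1, h2, h4, h5⟩
    refine ⟨⟨h1, h2⟩, ⟨fun C hC => Finset.disjoint_left.2 fun x hx hx' =>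
      ((h5 x).2 ⟨C, hC, hx'⟩).2 hx, h4⟩, fun x => ?_⟩
    rw [← h5]
    have := @h0 x
    tauto

/-- The sum of `X ^ l` over the admissible decorations `l` of a block of size `m`. -/
noncomputable def decorationPoly (m : ℕ) : ℚ[X] := ∑ l ∈ Finset.Ico 1 m, X ^ l

/-- The generating polynomial, by total decoration, of the hypersimplicial ordered set partitions
of a set with `n` elements. -/
noncomputable def partitionPoly : ℕ → ℚ[X]
  | 0 => 1
  | n + 1 => ∑ j : Fin (n + 1),
      ((n + 1).choose j : ℚ[X]) * (decorationPoly (n + 1 - j) * partitionPoly j)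

/-- Prepend to each member of `S (s \ B)` the block `B`, for `B` in `T`, with any admissible
decoration. -/
def consBlocks {α : Type*} [DecidableEq α] (s : Finset α) (T : Finset (Finset α))
    (S : Finset α → Finset (List (Finset α × ℕ))) : Finset (List (Finset α × ℕ)) :=
  (T.sigma fun B => Finset.Ico 1 B.card ×ˢ S (s \ B)).map
    ⟨fun x => (x.1, x.2.1) :: x.2.2, by
      rintro ⟨B, l, P⟩ ⟨C, k, Q⟩ h
      simp only [List.cons.injEq, Prod.mk.injEq] at h
      obtain ⟨⟨rfl, rfl⟩, rfl⟩ := h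
      rfl⟩

theorem cons_mem_consBlocks {α : Type*} [DecidableEq α] {s : Finset α} {T : Finset (Finset α)}
    {S : Finset α → Finset (List (Finset α × ℕ))} {B : Finset α × ℕ}
    {P : List (Finset α × ℕ)} :
    B :: P ∈ consBlocks s T S ↔ B.1 ∈ T ∧ (1 ≤ B.2 ∧ B.2 < B.1.card) ∧ P ∈ S (s \ B.1) := by
  simp only [consBlocks, Finset.mem_map, Finset.mem_sigma, Finset.mem_product, Finset.mem_Ico]
  constructor
  · rintro ⟨x, h, hx⟩
    obtain ⟨rfl, rfl⟩ := List.cons.inj hx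
    exact h
  · intro h
    exact ⟨⟨B.1, B.2, P⟩, h, rfl⟩

theorem nil_notMem_consBlocks {α : Type*} [DecidableEq α] {s : Finset α} {T : Finset (Finset α)}
    {S : Finset α → Finset (List (Finset α × ℕ))} : [] ∉ consBlocks s T S := by
  simp [consBlocks]

theorem sum_consBlocks {α : Type*} [DecidableEq α] (s : Finset α) (T : Finset (Finset α))
    (S : Finset α → Finset (List (Finset α × ℕ))) :
    ∑ P ∈ consBlocks s T S, (X : ℚ[X]) ^ (P.map Prod.snd).sum =
      ∑ B ∈ T, decorationPoly B.card *
        ∑ P ∈ S (s \ B), (X : ℚ[X]) ^ (P.map Prod.snd).sum := by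
  simp only [consBlocks, Finset.sum_map, Finset.sum_sigma, Finset.sum_product,
    decorationPoly, Finset.sum_mul_sum, ← pow_add]
  rfl

theorem partitionPoly_eq_sum {n : ℕ} (hn : n ≠ 0) :
    partitionPoly n = ∑ j ∈ Finset.range (n + 1),
      n.choose j • (decorationPoly j * partitionPoly (n - j)) := by
  obtain ⟨n, rfl⟩ := Nat.exists_eq_succ_of_ne_zero hn
  rw [← Finset.sum_range_reflect, Finset.sum_range_succ]
  simp only [Nat.succ_eq_add_one, Nat.add_sub_cancel, Nat.sub_self]
  rw [partitionPoly, Finset.sum_range]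
  simp only [nsmul_eq_mul]
  rw [show decorationPoly 0 = 0 by simp [decorationPoly], zero_mul, mul_zero, add_zero]
  refine Finset.sum_congr rfl fun j _ => ?_
  rw [Nat.choose_symm (by omega), Nat.sub_sub_self (by omega)]

theorem exists_finset_isHypersimplicial {α : Type*} [DecidableEq α] (s : Finset α) :
    ∃ S : Finset (List (Finset α × ℕ)), (∀ P, P ∈ S ↔ IsHypersimplicial s P) ∧
      ∑ P ∈ S, (X : ℚ[X]) ^ (P.map Prod.snd).sum = partitionPoly s.card := by
  induction s using Finset.strongInduction with
  | H s ih =>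
    rcases s.eq_empty_or_nonempty with rfl | hs
    · refine ⟨{[]}, fun P => ?_, by simp [partitionPoly]⟩
      cases P with
      | nil => simp [isHypersimplicial_nil]
      | cons B P =>
        simp only [Finset.mem_singleton, reduceCtorEq, isHypersimplicial_cons, false_iff,
          Finset.subset_empty]
        rintro ⟨h, h', -⟩
        simp [h] at h'
    · have ih' : ∀ t : Finset α, ∃ S : Finset (List (Finset α × ℕ)), t ⊂ s →
          (∀ P, P ∈ S ↔ IsHypersimplicial t P) ∧
          ∑ P ∈ S, (X : ℚ[X]) ^ (P.map Prod.snd).sum = partitionPoly t.card := by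
        intro t
        by_cases ht : t ⊂ s
        · obtain ⟨S, hS⟩ := ih t ht
          exact ⟨S, fun _ => hS⟩
        · exact ⟨∅, fun h => absurd h ht⟩
      choose S hS using ih'
      refine ⟨consBlocks s s.powerset S, fun P => ?_, ?_⟩
      · cases P with
        | nil => simp [nil_notMem_consBlocks, isHypersimplicial_nil, hs.ne_empty]
        | cons B P =>
          rw [cons_mem_consBlocks, isHypersimplicial_cons, Finset.mem_powerset]
          refine and_congr_right fun h => and_congr_right fun h' => ?_
          exact (hS _ (Finset.sdiff_ssubset h (Finset.card_pos.1 (by omega)))).1 P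
      · rw [sum_consBlocks, partitionPoly_eq_sum (Finset.card_pos.2 hs).ne',
          ← Finset.sum_powerset_apply_card
            (fun j => decorationPoly j * partitionPoly (s.card - j))]
        refine Finset.sum_congr rfl fun B hB => ?_
        rcases B.eq_empty_or_nonempty with rfl | hB'
        · simp [decorationPoly]
        · have hB := Finset.mem_powerset.1 hB
          rw [(hS _ (Finset.sdiff_ssubset hB hB')).2, Finset.card_sdiff_of_subset hB]

/-- The generating polynomial, by total decoration, of the hypersimplicial ordered set partitions
of a set with `n + 1` elements whose first block holds a given element. -/
noncomputable def pointedPartitionPoly (n : ℕ) : ℚ[X] :=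
  ∑ j ∈ Finset.range (n + 1), n.choose j • (decorationPoly (j + 1) * partitionPoly (n - j))

theorem exists_finset_isHypersimplicial_mem_head {α : Type*} [DecidableEq α] (s : Finset α)
    (a : α) (ha : a ∉ s) :
    ∃ S : Finset (List (Finset α × ℕ)),
      (∀ P, P ∈ S ↔ IsHypersimplicial (insert a s) P ∧ a ∈ P.headI.1) ∧
      ∑ P ∈ S, (X : ℚ[X]) ^ (P.map Prod.snd).sum = pointedPartitionPoly s.card := by
  choose S hS hS' using exists_finset_isHypersimplicial (α := α)
  refine ⟨consBlocks (insert a s) (s.powerset.image (insert a)) S, fun P => ?_, ?_⟩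
  · cases P with
    | nil => simp [nil_notMem_consBlocks, isHypersimplicial_nil]
    | cons B P =>
      have hB : B.1 ∈ s.powerset.image (insert a) ↔ B.1 ⊆ insert a s ∧ a ∈ B.1 := by
        simp only [Finset.mem_image, Finset.mem_powerset]
        constructor
        · rintro ⟨t, ht, h⟩
          rw [← h]
          exact ⟨Finset.insert_subset_insert a ht, Finset.mem_insert_self a t⟩
        · rintro ⟨h, h'⟩
          exact ⟨B.1.erase a, Finset.subset_insert_iff.1 h, Finset.insert_erase h'⟩
      rw [cons_mem_consBlocks, isHypersimplicial_cons, hB, hS, List.headI_cons]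
      tauto
  · have hinj : Set.InjOn (insert a) (s.powerset : Set (Finset α)) := by
      intro t ht u hu h
      have ht' := Finset.notMem_mono (Finset.mem_powerset.1 ht) ha
      have hu' := Finset.notMem_mono (Finset.mem_powerset.1 hu) ha
      rw [← Finset.erase_insert ht', h, Finset.erase_insert hu']
    rw [sum_consBlocks, Finset.sum_image hinj, pointedPartitionPoly,
      ← Finset.sum_powerset_apply_card
        (fun j => decorationPoly (j + 1) * partitionPoly (s.card - j))]
    refine Finset.sum_congr rfl fun t ht => ?_
    have ht := Finset.mem_powerset.1 ht
    rw [hS', Finset.card_sdiff_of_subset (Finset.insert_subset_insert a ht),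
      Finset.card_insert_of_notMem ha, Finset.card_insert_of_notMem (Finset.notMem_mono ht ha),
      Nat.add_sub_add_right]

/-- The exponential generating function of a sequence of polynomials. -/
noncomputable def egf (u : ℕ → ℚ[X]) : PowerSeries ℚ[X] :=
  PowerSeries.mk fun n => C (1 / (n.factorial : ℚ)) * u n

theorem egf_injective : Function.Injective egf := by
  intro u v h
  funext n
  have h := congrArg (PowerSeries.coeff n) h
  simp only [egf, PowerSeries.coeff_mk] at h
  refine mul_left_cancel₀ ?_ h
  simp [Nat.factorial_ne_zero]

theorem egf_add (u v : ℕ → ℚ[X]) : egf u + egf v = egf (u + v) := by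
  ext1 n
  simp [egf, mul_add]

theorem C_mul_egf (p : ℚ[X]) (u : ℕ → ℚ[X]) :
    PowerSeries.C p * egf u = egf fun n => p * u n := by
  ext1 n
  simp only [egf, PowerSeries.coeff_C_mul, PowerSeries.coeff_mk]
  ring

theorem one_eq_egf : (1 : PowerSeries ℚ[X]) = egf fun n => if n = 0 then 1 else 0 := by
  ext1 n
  rw [PowerSeries.coeff_one, egf, PowerSeries.coeff_mk]
  split_ifs with h <;> simp [h]

theorem egf_mul (u v : ℕ → ℚ[X]) :
    egf u * egf v = egf fun n => ∑ kl ∈ Finset.HasAntidiagonal.antidiagonal n,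
      (n.choose kl.1 : ℚ[X]) * (u kl.1 * v kl.2) := by
  ext1 n
  simp only [egf, PowerSeries.coeff_mul, PowerSeries.coeff_mk, Finset.mul_sum]
  refine Finset.sum_congr rfl fun kl h => ?_
  have h := Finset.HasAntidiagonal.mem_antidiagonal.1 h
  have hc : C (1 / (kl.1.factorial : ℚ)) * C (1 / (kl.2.factorial : ℚ)) =
      C (1 / (n.factorial : ℚ)) * (n.choose kl.1 : ℚ[X]) := by
    rw [← C_eq_natCast, ← C_mul, ← C_mul, ← h, Nat.cast_add_choose]
    congr 1
    field_simp
  linear_combination (u kl.1 * v kl.2) * hc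

theorem rescale_exp_eq_egf (p : ℚ[X]) :
    PowerSeries.rescale p (PowerSeries.exp ℚ[X]) = egf fun n => p ^ n := by
  ext1 n
  rw [PowerSeries.coeff_rescale, PowerSeries.coeff_exp, egf, PowerSeries.coeff_mk, mul_comm]
  rfl

theorem egf_pow_mul_egf_pow (p q : ℚ[X]) :
    egf (fun n => p ^ n) * egf (fun n => q ^ n) = egf fun n => (p + q) ^ n := by
  simp only [← rescale_exp_eq_egf, PowerSeries.exp_mul_exp_eq_exp_add]

theorem one_sub_X_mul_decorationPoly_succ (n : ℕ) :
    (1 - X) * decorationPoly (n + 1) = X * (1 - X ^ n) := by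
  induction n with
  | zero => simp [decorationPoly]
  | succ n ih =>
    rw [decorationPoly, Finset.sum_Ico_succ_top (by omega), ← decorationPoly, mul_add, ih]
    ring

theorem one_sub_X_mul_decorationPoly (n : ℕ) :
    (1 - X) * decorationPoly n = X - X ^ n + if n = 0 then 1 - X else 0 := by
  cases n with
  | zero => simp [decorationPoly]
  | succ n =>
    rw [one_sub_X_mul_decorationPoly_succ, if_neg (Nat.succ_ne_zero n)]
    ring

theorem egf_eulerianPoly :
    (egf (fun n => (X - 1) ^ n) - PowerSeries.C X) * egf eulerianPoly = PowerSeries.C (1 - X) := by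
  have h : egf (fun n => (X - 1) ^ n) * egf eulerianPoly =
      PowerSeries.C X * egf eulerianPoly + PowerSeries.C (1 - X) * 1 := by
    rw [one_eq_egf, C_mul_egf, C_mul_egf, egf_add, egf_mul]
    congr 1
    funext n
    rw [sum_choose_mul_eulerianPoly]
    simp
  linear_combination h

theorem egf_partitionPoly :
    (egf (fun n => X ^ n) - PowerSeries.C X * egf (fun n => 1 ^ n)) * egf partitionPoly =
      PowerSeries.C (1 - X) := by
  have h1 : PowerSeries.C (1 - X) * egf decorationPoly + egf (fun n => X ^ n) =
      PowerSeries.C X * egf (fun n => 1 ^ n) + PowerSeries.C (1 - X) * 1 := by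
    rw [one_eq_egf, C_mul_egf, C_mul_egf, C_mul_egf, egf_add, egf_add]
    congr 1
    funext n
    simp only [Pi.add_apply, one_sub_X_mul_decorationPoly]
    split_ifs <;> simp
  have h2 : egf partitionPoly = egf decorationPoly * egf partitionPoly + 1 := by
    rw [one_eq_egf, egf_mul, egf_add]
    congr 1
    funext n
    rw [Pi.add_apply]
    by_cases hn : n = 0
    · subst hn
      simp [partitionPoly, decorationPoly]
    · rw [partitionPoly_eq_sum hn, if_neg hn, add_zero,
        Finset.Nat.sum_antidiagonal_eq_sum_range_succ_mk]
      simp only [nsmul_eq_mul]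
  linear_combination egf partitionPoly * h1 + PowerSeries.C (1 - X) * h2

theorem egf_pointedPartitionPoly :
    PowerSeries.C (1 - X) * egf pointedPartitionPoly =
      PowerSeries.C X * (egf (fun n => 1 ^ n) - egf (fun n => X ^ n)) * egf partitionPoly := by
  have h1 : PowerSeries.C (1 - X) * egf (fun n => decorationPoly (n + 1)) +
      PowerSeries.C X * egf (fun n => X ^ n) = PowerSeries.C X * egf (fun n => 1 ^ n) := by
    rw [C_mul_egf, C_mul_egf, C_mul_egf, egf_add]
    congr 1
    funext n
    rw [Pi.add_apply, one_sub_X_mul_decorationPoly_succ]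
    ring
  have h2 : egf pointedPartitionPoly = egf (fun n => decorationPoly (n + 1)) * egf partitionPoly := by
    rw [egf_mul]
    congr 1
    funext n
    rw [pointedPartitionPoly, Finset.Nat.sum_antidiagonal_eq_sum_range_succ_mk]
    simp only [nsmul_eq_mul]
  linear_combination egf partitionPoly * h1 + PowerSeries.C (1 - X) * h2

theorem pointedPartitionPoly_eq {n : ℕ} (hn : n ≠ 0) :
    pointedPartitionPoly n = X * eulerianPoly n := by
  have hX : (PowerSeries.C (1 - X : ℚ[X])) ≠ 0 := by
    rw [Ne, map_eq_zero_iff _ PowerSeries.C_injective, sub_eq_zero]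
    exact fun h => X_ne_C (1 : ℚ) (by simpa using h.symm)
  have hD := egf_partitionPoly
  have hA := egf_eulerianPoly
  have hP := egf_pointedPartitionPoly
  have hE : egf (fun n => (X - 1) ^ n) * egf (fun n => 1 ^ n) = egf fun n => X ^ n := by
    rw [egf_pow_mul_egf_pow, sub_add_cancel]
  have hD0 : egf (fun n => X ^ n) - PowerSeries.C X * egf (fun n => 1 ^ n) ≠ 0 := by
    intro h
    rw [h, zero_mul] at hD
    exact hX hD.symm
  have h : egf pointedPartitionPoly + PowerSeries.C X * 1 = PowerSeries.C X * egf eulerianPoly := by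
    refine mul_left_cancel₀ (mul_ne_zero hX hD0) ?_
    have hC : PowerSeries.C (1 - X : ℚ[X]) = 1 - PowerSeries.C X := by simp
    rw [hC] at hD hA hP ⊢
    linear_combination
      (egf (fun n => X ^ n) - PowerSeries.C X * egf (fun n => 1 ^ n)) * hP
      + PowerSeries.C X * (egf (fun n => 1 ^ n) - egf (fun n => X ^ n)) * hD
      - (1 - PowerSeries.C X) * PowerSeries.C X * egf (fun n => 1 ^ n) * hA
      + (1 - PowerSeries.C X) * PowerSeries.C X * egf eulerianPoly * hE
  rw [one_eq_egf, C_mul_egf, C_mul_egf, egf_add] at h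
  simpa [hn] using congrFun (egf_injective h) n

/-- for `1 ≤ a < n`, the number of hypersimplicial ordered set
partitions of type `(a,n)` with `1 ∈ L₁` equals the Eulerian number counting
permutations of `{1,…,n−1}` with exactly `a−1` descents. -/
theorem card_hypersimplicial_eq_eulerian (n a : ℕ) (ha : 1 ≤ a) (han : a < n) :
    Nat.card {P : List (Finset (Fin n) × ℕ) //
        IsDOSP n a P ∧ (∀ B ∈ P, B.2 < B.1.card) ∧ FirstBlock P}
      = (Finset.univ.filter
          (fun σ : Equiv.Perm (Fin (n - 1)) => (descentSet σ).card = a - 1)).card := by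
  obtain ⟨m, rfl⟩ : ∃ m, n = m + 1 := ⟨n - 1, by omega⟩
  obtain ⟨S, hS, hsum⟩ := exists_finset_isHypersimplicial_mem_head
    ((Finset.univ : Finset (Fin (m + 1))).erase 0) 0 (Finset.notMem_erase _ _)
  rw [Finset.insert_erase (Finset.mem_univ _)] at hS
  rw [Finset.card_erase_of_mem (Finset.mem_univ _), Finset.card_univ, Fintype.card_fin,
    Nat.add_sub_cancel, pointedPartitionPoly_eq (by omega), eulerianPoly] at hsum
  have hcoeff := congrArg (fun p => coeff p a) hsum
  obtain ⟨b, rfl⟩ : ∃ b, a = b + 1 := ⟨a - 1, by omega⟩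
  simp only [coeff_X_mul, finsetSum_coeff, coeff_X_pow, Finset.sum_boole, Nat.cast_inj] at hcoeff
  have hP : ∀ P : List (Finset (Fin (m + 1)) × ℕ),
      (IsDOSP (m + 1) (b + 1) P ∧ (∀ B ∈ P, B.2 < B.1.card) ∧ FirstBlock P) ↔
        P ∈ S.filter fun P => b + 1 = (P.map Prod.snd).sum := by
    intro P
    have hF : FirstBlock P ↔ 0 ∈ P.headI.1 :=
      ⟨fun h => h 0 rfl, fun h x hx => (Fin.ext hx : x = 0) ▸ h⟩
    rw [Finset.mem_filter, hS, hF, IsDOSP, IsHypersimplicial]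
    simp only [Finset.mem_univ, true_iff]
    constructor
    · rintro ⟨⟨h1, h2, h3, h4⟩, h5, h6⟩
      exact ⟨⟨⟨fun B hB => ⟨(h1 B hB).2, h5 B hB⟩, h2, h3⟩, h6⟩, h4.symm⟩
    · rintro ⟨⟨⟨h1, h2, h3⟩, h6⟩, h4⟩
      exact ⟨⟨fun B hB => ⟨Finset.card_pos.1 ((Nat.zero_le _).trans_lt (h1 B hB).2), (h1 B hB).1⟩,
        h2, h3, h4.symm⟩, fun B hB => (h1 B hB).2, h6⟩
  rw [Nat.card_congr (Equiv.subtypeEquivRight hP), Nat.card_eq_fintype_card, Fintype.card_coe,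
    hcoeff]
  congr 1
  ext σ
  simp [eq_comm]
end

section
/- (Conjecture 1.) Fix integers 1 ≤ a < n. For each d ≥ 0 let m_d be the number of hypersimplicial ordered set partitions of type (a,n) with 1 ∈ L₁ and winding number d. Then in the ring of formal power series ℤ[[x]], (1−x)^n · Σ_{s≥0} E(s) x^s = Σ_{d≥0} m_d x^d, where E(s) is the number of integer vectors y ∈ ℤ^n with 0 ≤ y_i ≤ s for all i and y₁+⋯+y_n = a·s; that is, (m_0, m_1, m_2, …) is the Ehrhart h*-vector of the hypersimplex B_{a,n−a}. -/
section Hypersimplex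
open Finset

theorem coeff_mk_one_pow {R : Type*} [CommRing R] (p k : ℕ) :
    PowerSeries.coeff k ((PowerSeries.mk 1 : PowerSeries R) ^ p) = (p.multichoose k : R) := by
  cases p with
  | zero => cases k <;> simp [PowerSeries.coeff_one]
  | succ p =>
    rw [PowerSeries.mk_one_pow_eq_mk_choose_add, PowerSeries.coeff_mk, Nat.multichoose_eq,
      show p + 1 + k - 1 = p + k by omega, Nat.choose_symm_add]

theorem card_box_eq_coeff (n s K : ℕ) :
    (#{y ∈ Fintype.piFinset (fun _ : Fin n => range (s + 1)) | ∑ i, y i = K} : ℤ) =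
      PowerSeries.coeff K ((∑ i ∈ range (s + 1), (PowerSeries.X : PowerSeries ℤ) ^ i) ^ n) := by
  rw [sum_pow', map_sum, card_filter]
  push_cast
  refine sum_congr rfl fun y _ => ?_
  rw [prod_pow_eq_pow_sum, PowerSeries.coeff_X_pow]
  simp only [eq_comm]

theorem card_box (n s a : ℕ) (han : a < n) :
    (#{y ∈ Fintype.piFinset (fun _ : Fin n => range (s + 1)) | ∑ i, y i = a * s} : ℤ) =
      ∑ j ∈ range (a + 1), (-1 : ℤ) ^ j * (n.choose j : ℤ) *
        ((s * (a - j) + n - 1 - j).choose (n - 1) : ℤ) := by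
  have hgeom : (∑ i ∈ range (s + 1), (PowerSeries.X : PowerSeries ℤ) ^ i) =
      (1 - PowerSeries.X ^ (s + 1)) * PowerSeries.mk 1 := by
    rw [← mul_neg_geom_sum, mul_right_comm, mul_comm (1 - _) (PowerSeries.mk 1),
      PowerSeries.mk_one_mul_one_sub_eq_one, one_mul]
  have hbin : (1 - (PowerSeries.X : PowerSeries ℤ) ^ (s + 1)) ^ n =
      ∑ j ∈ range (n + 1), PowerSeries.C ((-1) ^ j * (n.choose j : ℤ)) *
        PowerSeries.X ^ (j * (s + 1)) := by
    rw [sub_eq_neg_add, add_pow]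
    refine sum_congr rfl fun j _ => ?_
    simp only [map_mul, map_pow, map_neg, map_one, map_natCast, one_pow, mul_one]
    rw [neg_pow, ← pow_mul, mul_comm j]
    ring
  rw [card_box_eq_coeff, hgeom, mul_pow, hbin, sum_mul, map_sum]
  symm
  refine sum_subset_zero_on_sdiff (range_subset_range.2 (by omega)) ?_ ?_
  · intro j hj
    simp only [mem_sdiff, mem_range, not_lt] at hj
    rw [mul_assoc, PowerSeries.coeff_C_mul, PowerSeries.coeff_X_pow_mul', if_neg, mul_zero]
    nlinarith
  · intro j hj
    simp only [mem_range] at hj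
    rw [mul_assoc (PowerSeries.C _), PowerSeries.coeff_C_mul, PowerSeries.coeff_X_pow_mul',
      coeff_mk_one_pow]
    congr 1
    obtain ⟨i, rfl⟩ : ∃ i, a = j + i := ⟨a - j, by omega⟩
    rw [show j + i - j = i by omega]
    split_ifs with h
    · have h1 : j ≤ s * i := by nlinarith
      have h2 : (j + i) * s - j * (s + 1) = s * i - j := by
        zify [h, h1]; ring
      rw [h2, Nat.multichoose_eq, show n + (s * i - j) - 1 = s * i + n - 1 - j by omega,
        Nat.choose_symm_of_eq_add (show s * i + n - 1 - j = (s * i - j) + (n - 1) by omega)]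
    · have h1 : s * i < j := by nlinarith
      rw [Nat.choose_eq_zero_of_lt (by omega)]
      simp

open PowerSeries in
/-- `t + t² + ⋯ + t^(f-1)`, the decorations allowed for a block of size `f`. -/
noncomputable def decorSeries (f : ℕ) : PowerSeries ℤ :=
  mk fun l => if 1 ≤ l ∧ l < f then 1 else 0

open PowerSeries in
theorem one_sub_X_mul_decorSeries {f : ℕ} (hf : 1 ≤ f) :
    (1 - X) * decorSeries f = X - X ^ f := by
  ext l
  rw [sub_mul, one_mul, map_sub, map_sub, coeff_X_pow, coeff_X]
  cases l with
  | zero => simp [decorSeries]; omega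
  | succ l =>
    rw [coeff_succ_X_mul]
    simp only [decorSeries, coeff_mk]
    split_ifs <;> omega

section Generating
open PowerSeries

/-- `1 / (1 - z)` in `ℤ[[t]][[z]]`. -/
noncomputable def geomZ : PowerSeries (PowerSeries ℤ) := mk 1

/-- `1 / (1 - t z)` in `ℤ[[t]][[z]]`. -/
noncomputable def geomTZ : PowerSeries (PowerSeries ℤ) := rescale X geomZ

/-- The generating function of a block that is not the first one. -/
noncomputable def blockSeries (s : ℕ) : PowerSeries (PowerSeries ℤ) :=
  mk fun f => (s.multichoose f : PowerSeries ℤ) * decorSeries f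

/-- The generating function of the first block. -/
noncomputable def firstBlockSeries (s : ℕ) : PowerSeries (PowerSeries ℤ) :=
  mk fun f => ((s + 1).multichoose (f - 1) : PowerSeries ℤ) * decorSeries f

theorem geomZ_mul : geomZ * (1 - X) = 1 := mk_one_mul_one_sub_eq_one _

theorem geomTZ_mul : geomTZ * (1 - C X * X) = 1 := by
  have h := congrArg (rescale (X : PowerSeries ℤ)) geomZ_mul
  rwa [map_mul, map_sub, map_one, rescale_X] at h

theorem coeff_geomZ_pow (p k : ℕ) : coeff k (geomZ ^ p) = (p.multichoose k : PowerSeries ℤ) :=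
  coeff_mk_one_pow p k

theorem coeff_geomTZ_pow (p k : ℕ) :
    coeff k (geomTZ ^ p) = X ^ k * (p.multichoose k : PowerSeries ℤ) := by
  rw [geomTZ, ← map_pow, coeff_rescale, coeff_geomZ_pow]

theorem one_sub_mul_blockSeries (s : ℕ) :
    (1 - C X) * blockSeries s = C X * (geomZ ^ s - 1) - (geomTZ ^ s - 1) := by
  ext1 f
  rw [show (1 - C X : PowerSeries (PowerSeries ℤ)) = C (1 - X) by simp, coeff_C_mul, map_sub,
    coeff_C_mul, map_sub, map_sub, coeff_geomZ_pow, coeff_geomTZ_pow, blockSeries, coeff_mk]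
  rcases Nat.eq_zero_or_pos f with rfl | hf
  · have : decorSeries 0 = 0 := by ext; simp [decorSeries]
    simp [this]
  · rw [coeff_one, if_neg (by omega)]
    linear_combination (s.multichoose f : PowerSeries ℤ) * one_sub_X_mul_decorSeries hf

theorem one_sub_mul_firstBlockSeries (s : ℕ) :
    (1 - C X) * firstBlockSeries s = C X * X * (geomZ ^ (s + 1) - geomTZ ^ (s + 1)) := by
  ext1 f
  rw [show (1 - C X : PowerSeries (PowerSeries ℤ)) = C (1 - X) by simp, coeff_C_mul, mul_assoc,
    coeff_C_mul, firstBlockSeries, coeff_mk]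
  cases f with
  | zero =>
    have : decorSeries 0 = 0 := by ext; simp [decorSeries]
    simp [this]
  | succ f =>
    rw [coeff_succ_X_mul, map_sub, coeff_geomZ_pow, coeff_geomTZ_pow, Nat.add_sub_cancel]
    linear_combination ((s + 1).multichoose f : PowerSeries ℤ) *
      one_sub_X_mul_decorSeries (f := f + 1) (by omega)

theorem firstBlockSeries_mul_eq (s M : ℕ) (D : PowerSeries (PowerSeries ℤ))
    (hD : (1 - blockSeries s) * D = 1) :
    firstBlockSeries s * D =
      X * ∑ i ∈ range M,
        (C X ^ (i + 1) * (geomZ ^ (s * (i + 1) + 1) * (1 - C X * X) ^ (s * (i + 1))) -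
          C X ^ (i + 1) * (geomZ ^ (s * i) * ((1 - C X * X) ^ (s * i) * geomTZ))) +
      C X ^ M * (geomZ ^ (s * M) * (1 - C X * X) ^ (s * M) * (firstBlockSeries s * D)) := by
  have hne : (1 - C X : PowerSeries (PowerSeries ℤ)) ≠ 0 := by
    intro h
    have h1 := congrArg (fun g => coeff 1 (coeff 0 g)) h
    simp [coeff_X] at h1
  set t : PowerSeries (PowerSeries ℤ) := C X with ht
  set α := geomZ ^ s with hα
  set β := (1 - t * X) ^ s with hβ
  have hwβ : geomTZ ^ s * β = 1 := by
    rw [hβ, ← mul_pow, geomTZ_mul, one_pow]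
  have hB := one_sub_mul_blockSeries s
  have hF := one_sub_mul_firstBlockSeries s
  rw [← ht] at hB hF
  set ρ := t * α * β with hρ
  have hρD : (1 - ρ) * D = (1 - t) * β := by
    linear_combination (1 - t) * β * hD + D * β * hB + (-D) * hwβ
  have hgeom : (1 - ρ) * ∑ i ∈ range M, ρ ^ i = 1 - ρ ^ M := mul_neg_geom_sum ρ M
  have hsum : ∑ i ∈ range M,
        (t ^ (i + 1) * (geomZ ^ (s * (i + 1) + 1) * (1 - t * X) ^ (s * (i + 1))) -
          t ^ (i + 1) * (geomZ ^ (s * i) * ((1 - t * X) ^ (s * i) * geomTZ))) =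
        t * (geomZ ^ (s + 1) - geomTZ ^ (s + 1)) * β * ∑ i ∈ range M, ρ ^ i := by
    rw [mul_sum]
    refine sum_congr rfl fun i _ => ?_
    rw [pow_add geomZ (s * (i + 1)), mul_add, mul_one, pow_add _ (s * i), pow_add _ (s * i),
      pow_mul, pow_mul, ← hα, ← hβ, hρ, pow_succ geomTZ]
    linear_combination (t ^ (i + 1) * α ^ i * β ^ i * geomTZ) * hwβ
  have hρM : ρ ^ M = t ^ M * (geomZ ^ (s * M) * (1 - t * X) ^ (s * M)) := by
    rw [hρ, pow_mul, pow_mul, ← hα, ← hβ]; ring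
  rw [hsum]
  apply mul_left_cancel₀ hne
  have : D = (1 - t) * β * ∑ i ∈ range M, ρ ^ i + ρ ^ M * D := by
    linear_combination (∑ i ∈ range M, ρ ^ i) * hρD - D * hgeom
  linear_combination (D - ρ ^ M * D) * hF +
    (t * X * (geomZ ^ (s + 1) - geomTZ ^ (s + 1))) * this +
    ((1 - t) * firstBlockSeries s * D) * hρM
theorem one_sub_CX_mul_X_pow (q : ℕ) :
    (1 - C X * X : PowerSeries (PowerSeries ℤ)) ^ q =
      mk fun j => (((-1 : ℤ) ^ j * (q.choose j : ℤ) : ℤ) : PowerSeries ℤ) * X ^ j := by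
  rw [sub_eq_neg_add, add_pow]
  ext1 j
  simp only [one_pow, mul_one, map_sum, coeff_mk]
  have : ∀ i, coeff j ((-(C X * X : PowerSeries (PowerSeries ℤ))) ^ i *
      (q.choose i : PowerSeries (PowerSeries ℤ))) =
      if j = i then (((-1 : ℤ) ^ j * (q.choose j : ℤ) : ℤ) : PowerSeries ℤ) * X ^ j else 0 := by
    intro i
    rw [show (-(C X * X : PowerSeries (PowerSeries ℤ))) ^ i *
        (q.choose i : PowerSeries (PowerSeries ℤ)) =
      C ((((-1 : ℤ) ^ i * (q.choose i : ℤ) : ℤ) : PowerSeries ℤ) * X ^ i) * X ^ i by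
        simp; rw [neg_pow, mul_pow]; ring, coeff_C_mul, coeff_X_pow]
    split_ifs with h
    · subst h; simp
    · simp
  rw [sum_congr rfl fun i _ => this i, sum_ite_eq]
  split_ifs with h
  · rfl
  · rw [mem_range, not_lt] at h
    rw [Nat.choose_eq_zero_of_lt (by omega)]
    simp

theorem coeff_coeff_geomZ_mul (p q m j : ℕ) (hj : j ≤ m) :
    coeff j (coeff m (geomZ ^ p * (1 - C X * X) ^ q)) =
      (-1) ^ j * (q.choose j : ℤ) * (p.multichoose (m - j) : ℤ) := by
  rw [one_sub_CX_mul_X_pow, mul_comm, coeff_mul, map_sum, sum_eq_single (j, m - j)]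
  · rw [coeff_geomZ_pow, coeff_mk]
    rw [← map_intCast (C : ℤ →+* PowerSeries ℤ), ← map_natCast (C : ℤ →+* PowerSeries ℤ),
      coeff_mul_C, coeff_C_mul, coeff_X_pow_self, mul_one]
    simp
  · rintro ⟨i, k⟩ hik hne
    rw [HasAntidiagonal.mem_antidiagonal] at hik
    rw [coeff_geomZ_pow, coeff_mk]
    rw [← map_intCast (C : ℤ →+* PowerSeries ℤ), ← map_natCast (C : ℤ →+* PowerSeries ℤ),
      coeff_mul_C, coeff_C_mul, coeff_X_pow, if_neg, mul_zero, zero_mul]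
    rintro rfl
    exact hne (by ext <;> simp; simp at hik; omega)
  · simp [hj]

theorem choose_identity (T n j : ℕ) (hj : j + 1 < n) :
    T.choose (j + 1) * (T + 1).multichoose (n - 1 - (j + 1)) +
      (T - 1).choose j * T.multichoose (n - 1 - j) =
    n.choose (j + 1) * (T + n - 1 - (j + 1)).choose (n - 1) := by
  obtain ⟨m, rfl⟩ : ∃ m, n = m + j + 2 := ⟨n - j - 2, by omega⟩
  rw [show m + j + 2 - 1 - (j + 1) = m by omega, show m + j + 2 - 1 - j = m + 1 by omega,
    show T + (m + j + 2) - 1 - (j + 1) = T + m by omega, show m + j + 2 - 1 = m + j + 1 by omega,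
    Nat.multichoose_eq, Nat.multichoose_eq, show T + 1 + m - 1 = T + m by omega,
    show T + (m + 1) - 1 = T + m by omega]
  rcases Nat.lt_or_ge T (j + 1) with h | h
  · rw [Nat.choose_eq_zero_of_lt h, Nat.choose_eq_zero_of_lt (show T + m < m + j + 1 by omega)]
    rcases Nat.eq_zero_or_pos T with rfl | hT
    · simp
    · rw [Nat.choose_eq_zero_of_lt (show T - 1 < j by omega)]
      simp
  · obtain ⟨d, rfl⟩ := Nat.exists_eq_add_of_le h
    rw [show j + 1 + d - 1 = j + d by omega,
      show (j + 1 + d + m).choose (m + j + 1) = (m + j + 1 + d).choose (m + j + 1) by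
        congr 1; omega,
      show (j + 1 + d + m).choose m = (m + (j + 1 + d)).choose m by congr 1; omega,
      show (j + 1 + d + m).choose (m + 1) = (m + 1 + (j + d)).choose (m + 1) by congr 1; omega,
      show (m + j + 2).choose (j + 1) = (j + 1 + (m + 1)).choose (j + 1) by congr 1; omega]
    have : (((j + 1 + d).choose (j + 1) * (m + (j + 1 + d)).choose m +
        (j + d).choose j * (m + 1 + (j + d)).choose (m + 1) : ℕ) : ℚ) =
        ((j + 1 + (m + 1)).choose (j + 1) * (m + j + 1 + d).choose (m + j + 1) : ℕ) := by
      push_cast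
      simp only [Nat.cast_add_choose]
      rw [show m + (j + 1 + d) = m + j + 1 + d by omega,
        show m + 1 + (j + d) = m + j + 1 + d by omega,
        show j + 1 + (m + 1) = m + j + 1 + 1 by omega, show j + 1 + d = j + d + 1 by omega]
      rw [Nat.factorial_succ (m + j + 1), Nat.factorial_succ m, Nat.factorial_succ j]
      push_cast
      have := fun k => Nat.cast_ne_zero (R := ℚ).2 (Nat.factorial_ne_zero k)
      have h1 := this (j + d + 1)
      have h2 := this (j + d)
      have h3 := this (m + j + 1)
      have h4 := this m
      have h5 := this j
      have h6 := this d
      field_simp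
      ring
    exact_mod_cast this

theorem coeff_coeff_geomZ_mul_geomTZ (T n j : ℕ) (hj : j + 1 < n) :
    coeff j (coeff (n - 1) (geomZ ^ T * ((1 - C X * X) ^ T * geomTZ))) =
      (-1) ^ j * ((T - 1).choose j : ℤ) * (T.multichoose (n - 1 - j) : ℤ) := by
  cases T with
  | zero =>
    have h := coeff_geomTZ_pow 1 (n - 1)
    rw [pow_one] at h
    rw [pow_zero, pow_zero, one_mul, one_mul, h, Nat.multichoose_one, Nat.cast_one, mul_one,
      coeff_X_pow, if_neg (by omega)]
    obtain ⟨k, hk⟩ : ∃ k, n - 1 - j = k + 1 := ⟨n - 2 - j, by omega⟩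
    simp [hk]
  | succ T =>
    rw [pow_succ (1 - C X * X), mul_assoc _ (1 - C X * X), mul_comm (1 - C X * X), geomTZ_mul,
      mul_one, coeff_coeff_geomZ_mul _ _ _ _ (by omega), Nat.add_sub_cancel]

theorem coeff_coeff_firstBlockSeries_mul (s a n : ℕ) (ha : 1 ≤ a) (han : a < n)
    (D : PowerSeries (PowerSeries ℤ)) (hD : (1 - blockSeries s) * D = 1) :
    coeff a (coeff n (firstBlockSeries s * D)) =
      ∑ j ∈ range (a + 1), (-1 : ℤ) ^ j * (n.choose j : ℤ) *
        ((s * (a - j) + n - 1 - j).choose (n - 1) : ℤ) := by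
  obtain ⟨m, rfl⟩ : ∃ m, n = m + 1 := ⟨n - 1, by omega⟩
  have key : ∀ (i : ℕ) (G : PowerSeries (PowerSeries ℤ)),
      coeff a (coeff m (C (X : PowerSeries ℤ) ^ (i + 1) * G)) =
        if i + 1 ≤ a then coeff (a - (i + 1)) (coeff m G) else 0 := by
    intro i G
    rw [← map_pow, coeff_C_mul, coeff_X_pow_mul']
  have key' : ∀ (G : PowerSeries (PowerSeries ℤ)),
      coeff a (coeff (m + 1) (C (X : PowerSeries ℤ) ^ (a + 1) * G)) = 0 := by
    intro G
    rw [← map_pow, coeff_C_mul, coeff_X_pow_mul', if_neg (by omega)]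
  rw [firstBlockSeries_mul_eq s (a + 1) D hD, map_add, map_add, key', add_zero, coeff_succ_X_mul,
    map_sum, map_sum, sum_range_succ]
  simp only [map_sub]
  rw [key a, key a, if_neg (by omega), if_neg (by omega), sub_self, add_zero, ← sum_range_reflect]
  have hterm : ∀ j ∈ range a,
      coeff a (coeff m (C X ^ (a - 1 - j + 1) * (geomZ ^ (s * (a - 1 - j + 1) + 1) *
          (1 - C X * X) ^ (s * (a - 1 - j + 1))))) -
        coeff a (coeff m (C X ^ (a - 1 - j + 1) * (geomZ ^ (s * (a - 1 - j)) *
          ((1 - C X * X) ^ (s * (a - 1 - j)) * geomTZ)))) =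
      (-1 : ℤ) ^ j * ((s * (a - j)).choose j : ℤ) * ((s * (a - j) + 1).multichoose (m - j) : ℤ) -
      (-1 : ℤ) ^ j * ((s * (a - (j + 1)) - 1).choose j : ℤ) *
        ((s * (a - (j + 1))).multichoose (m - j) : ℤ) := by
    intro j hj
    rw [mem_range] at hj
    rw [key, key, if_pos (by omega), if_pos (by omega), show a - (a - 1 - j + 1) = j by omega,
      show a - 1 - j + 1 = a - j by omega, show a - 1 - j = a - (j + 1) by omega,
      coeff_coeff_geomZ_mul _ _ _ _ (by omega)]
    have := coeff_coeff_geomZ_mul_geomTZ (s * (a - (j + 1))) (m + 1) j (by omega)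
    rw [Nat.add_sub_cancel] at this
    rw [this]
  rw [sum_congr rfl hterm, sum_sub_distrib]
  have hext : ∑ j ∈ range a, (-1 : ℤ) ^ j * ((s * (a - j)).choose j : ℤ) *
        ((s * (a - j) + 1).multichoose (m - j) : ℤ) =
      ∑ j ∈ range (a + 1), (-1 : ℤ) ^ j * ((s * (a - j)).choose j : ℤ) *
        ((s * (a - j) + 1).multichoose (m - j) : ℤ) := by
    rw [sum_range_succ, Nat.sub_self, mul_zero, Nat.choose_eq_zero_of_lt (by omega)]
    simp
  rw [hext, sum_range_succ', sum_range_succ' _ a, add_sub_right_comm, ← sum_sub_distrib]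
  congr 1
  · refine sum_congr rfl fun j hj => ?_
    rw [mem_range] at hj
    have h := choose_identity (s * (a - (j + 1))) (m + 1) j (by omega)
    rw [Nat.add_sub_cancel] at h
    zify at h
    rw [mul_assoc _ ((m + 1).choose (j + 1) : ℤ), Nat.add_sub_cancel, ← h]
    ring
  · simp only [Nat.choose_zero_right, Nat.sub_zero, Nat.add_sub_cancel, Nat.multichoose_eq]
    rw [show s * a + (m + 1) - 1 = s * a + 1 + m - 1 by omega]
end Generating

section Transfer

theorem sum_piAntidiag_fin_succ {M : Type*} [AddCommMonoid M] (a m : ℕ)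
    (G : (Fin (a + 1) → ℕ) → M) :
    ∑ g ∈ piAntidiag (univ : Finset (Fin (a + 1))) m, G g =
      ∑ p ∈ HasAntidiagonal.antidiagonal m, ∑ g ∈ piAntidiag (univ : Finset (Fin a)) p.2,
        G (Fin.cons p.1 g) := by
  rw [sum_sigma']
  refine sum_bij' (fun g _ => ⟨(g 0, m - g 0), Fin.tail g⟩)
    (fun p _ => Fin.cons p.1.1 p.2) ?_ ?_ ?_ ?_ ?_
  · intro g hg
    simp only [mem_piAntidiag, Fin.sum_univ_succ] at hg
    simp only [mem_sigma, HasAntidiagonal.mem_antidiagonal, mem_piAntidiag, Fin.tail]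
    refine ⟨by omega, ?_, by simp⟩
    change ∑ i : Fin a, g i.succ = _
    omega
  · rintro ⟨⟨f, m'⟩, g⟩ hg
    simp only [mem_sigma, HasAntidiagonal.mem_antidiagonal, mem_piAntidiag] at hg
    simp only [mem_piAntidiag, Fin.sum_univ_succ, Fin.cons_zero, Fin.cons_succ]
    have : ∑ i, g i = m' := hg.2.1
    exact ⟨by omega, by simp⟩
  · intro g hg
    simp
  · rintro ⟨⟨f, m'⟩, g⟩ hg
    simp only [mem_sigma, HasAntidiagonal.mem_antidiagonal, mem_piAntidiag] at hg
    simp only [Fin.cons_zero, Fin.tail_cons]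
    rw [show m - f = m' by omega]
  · intro g hg
    simp

/-- `GapsFit k L`: reading the list `L` of fibre sizes from left to right, every nonzero entry `f`
is followed by at most `f - 2` zeros, and `L` starts with at most `k` zeros. -/
def GapsFit : ℕ → List ℕ → Prop
  | _, [] => True
  | k, f :: t => (f = 0 ∧ 1 ≤ k ∧ GapsFit (k - 1) t) ∨ (2 ≤ f ∧ GapsFit (f - 2) t)

open Classical in
/-- The weighted count of the sequences of fibre sizes satisfying `GapsFit k`. -/
noncomputable def gapCount (s k a m : ℕ) : ℤ :=
  ∑ g ∈ piAntidiag (univ : Finset (Fin a)) m,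
    if GapsFit k (List.ofFn g) then ∏ v, (s.multichoose (g v) : ℤ) else 0

/-- The weighted count of the sequences of fibre sizes starting with a nonzero entry. -/
noncomputable def blockCount (s : ℕ) : ℕ → ℕ → ℤ
  | 0, m => if m = 0 then 1 else 0
  | a + 1, m => ∑ p ∈ HasAntidiagonal.antidiagonal m,
      if 2 ≤ p.1 then (s.multichoose p.1 : ℤ) * gapCount s (p.1 - 2) a p.2 else 0

theorem gapCount_zero (s k m : ℕ) : gapCount s k 0 m = if m = 0 then 1 else 0 := by
  rw [gapCount, univ_eq_empty, piAntidiag_empty]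
  split_ifs <;> simp [GapsFit]

theorem gapCount_succ (s k a m : ℕ) :
    gapCount s k (a + 1) m =
      (if 1 ≤ k then gapCount s (k - 1) a m else 0) + blockCount s (a + 1) m := by
  classical
  have h0 : (if 1 ≤ k then gapCount s (k - 1) a m else 0) =
      ∑ p ∈ HasAntidiagonal.antidiagonal m,
        if p.1 = 0 then (if 1 ≤ k then gapCount s (k - 1) a p.2 else 0) else 0 := by
    rw [sum_eq_single (0, m)]
    · simp
    · rintro ⟨f, m'⟩ hp hne
      rw [HasAntidiagonal.mem_antidiagonal] at hp
      rw [if_neg]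
      rintro rfl
      exact hne (by simp at hp; simp [hp])
    · simp
  rw [h0, blockCount, ← sum_add_distrib, gapCount, sum_piAntidiag_fin_succ]
  refine sum_congr rfl fun p _ => ?_
  simp only [List.ofFn_succ, Fin.cons_zero, Fin.cons_succ, GapsFit, Fin.prod_univ_succ, gapCount]
  by_cases h1 : p.1 = 0
  · by_cases h2 : 1 ≤ k
    · simp [h1, h2]
    · simp [h1, h2]
  · by_cases h2 : 2 ≤ p.1
    · simp [h1, h2, mul_sum]
    · simp [h1, h2]

theorem gapCount_eq_sum (s a : ℕ) : ∀ k m,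
    gapCount s k a m = ∑ i ∈ range (a + 1), if i ≤ k then blockCount s (a - i) m else 0 := by
  induction a with
  | zero => intro k m; simp [gapCount_zero, blockCount]
  | succ a ih =>
    intro k m
    rw [gapCount_succ, sum_range_succ', if_pos (Nat.zero_le _), Nat.sub_zero]
    congr 1
    split_ifs with hk
    · rw [ih]
      refine sum_congr rfl fun i _ => ?_
      rw [Nat.add_sub_add_right]
      simp only [show i ≤ k - 1 ↔ i + 1 ≤ k by omega]
    · refine (sum_eq_zero fun i _ => ?_).symm
      rw [if_neg (by omega)]

open PowerSeries

/-- The generating function of `blockCount`. -/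
noncomputable def blockCountSeries (s : ℕ) : PowerSeries (PowerSeries ℤ) :=
  mk fun m => mk fun a => blockCount s a m

theorem coeff_decorSeries_mul (s f a m : ℕ) :
    coeff (a + 1) (decorSeries f * coeff m (blockCountSeries s)) =
      if 2 ≤ f then gapCount s (f - 2) a m else 0 := by
  rw [coeff_mul, Nat.sum_antidiagonal_eq_sum_range_succ_mk, sum_range_succ']
  simp only [decorSeries, blockCountSeries, coeff_mk, Nat.add_sub_add_right]
  rw [if_neg (by omega), zero_mul, add_zero, gapCount_eq_sum]
  split_ifs with hf
  · refine sum_congr rfl fun i _ => ?_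
    rw [ite_mul, one_mul, zero_mul]
    simp only [show (1 ≤ i + 1 ∧ i + 1 < f) ↔ i ≤ f - 2 by omega]
  · refine sum_eq_zero fun i _ => ?_
    rw [if_neg (by omega), zero_mul]

theorem coeff_natCast_mul' (c a : ℕ) (G : PowerSeries ℤ) :
    coeff a ((c : PowerSeries ℤ) * G) = (c : ℤ) * coeff a G := by
  rw [← map_natCast (C : ℤ →+* PowerSeries ℤ), coeff_C_mul]

theorem one_sub_blockSeries_mul (s : ℕ) : (1 - blockSeries s) * blockCountSeries s = 1 := by
  ext m a
  rw [sub_mul, one_mul, map_sub, map_sub, sub_eq_iff_eq_add, coeff_mul, map_sum]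
  simp only [blockSeries, coeff_mk, mul_assoc, coeff_natCast_mul']
  cases a with
  | zero =>
    rw [sum_eq_zero]
    · simp only [blockCountSeries, coeff_mk, blockCount, coeff_one]
      split_ifs <;> simp
    · intro p _
      simp [decorSeries]
  | succ a =>
    have : coeff (a + 1) (coeff m (1 : PowerSeries (PowerSeries ℤ))) = 0 := by
      rw [coeff_one]; split_ifs <;> simp [coeff_one]
    rw [this, zero_add]
    simp only [coeff_decorSeries_mul]
    simp only [blockCountSeries, coeff_mk, blockCount, mul_ite, mul_zero]

open Classical in
theorem sum_gapsFit_eq (s a n : ℕ) :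
    ∑ g ∈ piAntidiag (univ : Finset (Fin (a + 1))) n,
      (if GapsFit 0 (List.ofFn fun v => g v + if v = 0 then 1 else 0) then
        ∏ v, ((s + if v = 0 then 1 else 0).multichoose (g v) : ℤ) else 0) =
    coeff (a + 1) (coeff (n + 1) (firstBlockSeries s * blockCountSeries s)) := by
  rw [coeff_mul, map_sum, Nat.antidiagonal_succ, sum_cons, sum_map, sum_piAntidiag_fin_succ]
  have h0 : decorSeries 0 = 0 := by ext; simp [decorSeries]
  simp only [firstBlockSeries, coeff_mk, mul_assoc, coeff_natCast_mul', h0, zero_mul, map_zero,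
    mul_zero, zero_add, Function.Embedding.coe_prodMap, Prod.map_fst, Prod.map_snd]
  refine sum_congr rfl fun p _ => ?_
  simp only [List.ofFn_succ, Fin.cons_zero, Fin.cons_succ, GapsFit, Fin.prod_univ_succ]
  rw [coeff_decorSeries_mul]
  by_cases h2 : 1 ≤ p.1
  · simp [h2, gapCount, mul_sum, Fin.succ_ne_zero]
  · simp [h2]

end Transfer

section PrefixSums
open Fin (partialSum)

theorem card_piAntidiag_univ {ι : Type*} [Fintype ι] [DecidableEq ι] (m : ℕ) :
    #(piAntidiag (univ : Finset ι) m) = (Fintype.card ι).multichoose m := by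
  rw [← map_sym_eq_piAntidiag, card_map, sym_univ, card_univ, Sym.card_sym_eq_multichoose]

theorem partialSum_last {n : ℕ} (y : Fin n → ℕ) : partialSum y (Fin.last n) = ∑ i, y i := by
  rw [partialSum, ← List.sum_ofFn, List.take_of_length_le (by simp)]

theorem monotone_partialSum {n : ℕ} (y : Fin n → ℕ) : Monotone (partialSum y) :=
  Fin.monotone_iff_le_succ.2 fun i => by rw [Fin.partialSum_succ]; omega

theorem partialSum_injective {n : ℕ} :
    Function.Injective (partialSum : (Fin n → ℕ) → Fin (n + 1) → ℕ) := by
  intro y y' h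
  ext j
  have h1 := Fin.partialSum_succ y j
  have h2 := Fin.partialSum_succ y' j
  rw [h] at h1
  omega

theorem monotone_eq_of_card_fiber_eq {n : ℕ} {c c' : Fin n → ℕ} (hc : Monotone c)
    (hc' : Monotone c') (h : ∀ x, #{j | c j = x} = #{j | c' j = x}) : c = c' := by
  have hcount : ∀ (d : Fin n → ℕ) (x : ℕ), (List.ofFn d).count x = #{j | d j = x} := by
    intro d x
    rw [← Multiset.coe_count, ← Fin.univ_val_map, Multiset.count_map, card_def, filter_val]
    simp only [eq_comm]
  exact List.ofFn_injective <| (List.perm_iff_count.2 fun x => by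
    rw [hcount, hcount, h]).eq_of_pairwise' hc.sortedLE_ofFn.pairwise hc'.sortedLE_ofFn.pairwise

/-- The number of indices `j` whose prefix sum `y_1 + ⋯ + y_{j-1}` is congruent to `v`
modulo `a`. -/
def residueCount {n : ℕ} (a : ℕ) (y : Fin n → ℕ) (v : Fin a) : ℕ :=
  #{j : Fin n | partialSum y j.castSucc % a = v}

/-- The integers of `{0, …, (a + 1) s}`, sorted by their residue modulo `a + 1`. -/
abbrev Cell (a s : ℕ) : Type := Σ v : Fin (a + 1), Fin (s + if v = 0 then 1 else 0)

theorem card_cell (a s : ℕ) : Fintype.card (Cell a s) = (a + 1) * s + 1 := by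
  simp [Fintype.card_sigma, sum_add_distrib]

theorem sum_cell_fiber {a s c : ℕ} (hc : c ≤ (a + 1) * s) (v : Fin (a + 1)) :
    ∑ b : Fin (s + if v = 0 then 1 else 0), (if c = b * (a + 1) + v then 1 else 0) =
      if c % (a + 1) = v then 1 else 0 := by
  have hdiv := Nat.div_add_mod c (a + 1)
  by_cases h : c % (a + 1) = v
  · rw [if_pos h]
    have hb : c / (a + 1) < s + if v = 0 then 1 else 0 := by
      split_ifs with hv
      · rw [Nat.lt_succ_iff]
        exact Nat.div_le_of_le_mul hc
      · have hv0 : (v : ℕ) ≠ 0 := fun h0 => hv (Fin.ext h0)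
        rw [add_zero]
        by_contra! hlt
        have := Nat.mul_le_mul_left (a + 1) hlt
        omega
    rw [sum_eq_single ⟨c / (a + 1), hb⟩]
    · rw [if_pos]
      simp only
      rw [mul_comm, ← h, hdiv]
    · intro b _ hne
      rw [if_neg]
      rintro rfl
      apply hne
      ext
      simp only
      rw [mul_comm, Nat.mul_add_div (by omega), Nat.div_eq_of_lt v.2, add_zero]
    · simp
  · rw [if_neg h]
    refine sum_eq_zero fun b _ => ?_
    rw [if_neg]
    rintro rfl
    apply h
    rw [mul_comm, Nat.mul_add_mod, Nat.mod_eq_of_lt v.2]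

/-- The number of nontrivial prefix sums of `y` equal to a given integer. -/
def cellCount {n : ℕ} (a s : ℕ) (y : Fin (n + 1) → ℕ) (x : Cell a s) : ℕ :=
  #{j : Fin n | partialSum y j.succ.castSucc = x.2 * (a + 1) + x.1}

theorem partialSum_le {n : ℕ} (y : Fin n → ℕ) (j : Fin (n + 1)) : partialSum y j ≤ ∑ i, y i :=
  partialSum_last y ▸ monotone_partialSum y (Fin.le_last j)

theorem sum_cellCount_fiber {n a s : ℕ} {y : Fin (n + 1) → ℕ} (hy : ∑ i, y i = (a + 1) * s)
    (v : Fin (a + 1)) :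
    ∑ b, cellCount a s y ⟨v, b⟩ = #{j : Fin n | partialSum y j.succ.castSucc % (a + 1) = v} := by
  simp only [cellCount, card_filter]
  rw [sum_comm]
  exact sum_congr rfl fun j _ => sum_cell_fiber (hy ▸ partialSum_le y _) v

theorem sum_cellCount {n a s : ℕ} {y : Fin (n + 1) → ℕ} (hy : ∑ i, y i = (a + 1) * s) :
    ∑ x, cellCount a s y x = n := by
  rw [Fintype.sum_sigma]
  simp only [sum_cellCount_fiber hy, card_filter]
  rw [sum_comm]
  have : ∀ c : ℕ, ∑ v : Fin (a + 1), (if c % (a + 1) = v then 1 else 0) = 1 := by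
    intro c
    rw [sum_eq_single ⟨c % (a + 1), Nat.mod_lt _ (by omega)⟩]
    · simp
    · intro b _ hb
      rw [if_neg]
      rintro h
      exact hb (Fin.ext h.symm)
    · simp
  simp [this]

theorem residueCount_eq {n a s : ℕ} {y : Fin (n + 1) → ℕ} (hy : ∑ i, y i = (a + 1) * s) :
    residueCount (a + 1) y = fun v => ∑ b, cellCount a s y ⟨v, b⟩ + if v = 0 then 1 else 0 := by
  ext v
  rw [sum_cellCount_fiber hy, residueCount, card_filter, Fin.sum_univ_succ, card_filter, add_comm]
  congr 1
  rw [Fin.castSucc_zero, Fin.partialSum_zero, Nat.zero_mod]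
  simp only [Fin.ext_iff, Fin.val_zero, eq_comm]

theorem cellCount_injOn (n a s : ℕ) :
    Set.InjOn (cellCount a s) {y : Fin (n + 1) → ℕ | ∑ i, y i = (a + 1) * s} := by
  intro y hy y' hy' h
  simp only [Set.mem_ofPred_eq] at hy hy'
  have key : (fun j : Fin n => partialSum y j.succ.castSucc) =
      fun j : Fin n => partialSum y' j.succ.castSucc := by
    refine monotone_eq_of_card_fiber_eq ?_ ?_ fun x => ?_
    · exact fun i j hij => monotone_partialSum y (by simpa using hij)
    · exact fun i j hij => monotone_partialSum y' (by simpa using hij)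
    by_cases hx : x ≤ (a + 1) * s
    · have hsum := sum_cell_fiber hx ⟨x % (a + 1), Nat.mod_lt _ (by omega)⟩
      rw [if_pos rfl] at hsum
      obtain ⟨b, -, hb⟩ := exists_ne_zero_of_sum_ne_zero (by rw [hsum]; exact one_ne_zero)
      have hb' := by simpa using hb
      have := congrFun h ⟨⟨x % (a + 1), Nat.mod_lt _ (by omega)⟩, b⟩
      simp only [cellCount] at this
      rwa [← hb'] at this
    · rw [filter_false_of_mem, filter_false_of_mem]
      · intro j _ hj
        exact hx (hj ▸ hy' ▸ partialSum_le y' _)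
      · intro j _ hj
        exact hx (hj ▸ hy ▸ partialSum_le y _)
  apply partialSum_injective
  ext j
  induction j using Fin.lastCases with
  | last => rw [partialSum_last, partialSum_last, hy, hy']
  | cast j =>
    induction j using Fin.cases with
    | zero => simp
    | succ j => exact congrFun key j

theorem card_sigma_fiber {ι : Type*} [Fintype ι] [DecidableEq ι] {κ : ι → Type*}
    [∀ i, Fintype (κ i)] [∀ i, DecidableEq (κ i)] (m : ℕ) (g : ι → ℕ) (hg : ∑ i, g i = m) :
    #{N ∈ piAntidiag (univ : Finset (Σ i, κ i)) m | (fun i => ∑ b, N ⟨i, b⟩) = g} =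
      ∏ i, (Fintype.card (κ i)).multichoose (g i) := by
  simp only [← card_piAntidiag_univ]
  rw [← Fintype.card_piFinset]
  refine card_nbij' (fun N i b => N ⟨i, b⟩) (fun N x => N x.1 x.2) ?_ ?_ ?_ ?_
  · intro N hN
    simp only [coe_filter, Set.mem_ofPred_eq] at hN
    simp [← hN.2]
  · intro N hN
    simp only [mem_coe, Fintype.mem_piFinset, mem_piAntidiag] at hN
    simp only [coe_filter, Set.mem_ofPred_eq, mem_piAntidiag, Fintype.sum_sigma]
    exact ⟨⟨by rw [← hg]; exact sum_congr rfl fun i _ => (hN i).1, by simp⟩,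
      funext fun i => (hN i).1⟩
  · intro N _; rfl
  · intro N _; rfl

open Classical in
theorem card_residueCount (n a s : ℕ) (G : (Fin (a + 1) → ℕ) → Prop) :
    #{y ∈ piAntidiag (univ : Finset (Fin (n + 1))) ((a + 1) * s) | G (residueCount (a + 1) y)} =
    ∑ g ∈ piAntidiag (univ : Finset (Fin (a + 1))) n,
      if G (fun v => g v + if v = 0 then 1 else 0) then
        ∏ v, (s + if v = 0 then 1 else 0).multichoose (g v) else 0 := by
  have hmaps : Set.MapsTo (cellCount a s)
      (piAntidiag (univ : Finset (Fin (n + 1))) ((a + 1) * s) : Set (Fin (n + 1) → ℕ))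
      (piAntidiag (univ : Finset (Cell a s)) n) := by
    intro y hy
    simp only [mem_coe, mem_piAntidiag] at hy ⊢
    exact ⟨sum_cellCount hy.1, by simp⟩
  have himage : (piAntidiag (univ : Finset (Fin (n + 1))) ((a + 1) * s)).image (cellCount a s) =
      piAntidiag (univ : Finset (Cell a s)) n := by
    apply eq_of_subset_of_card_le (image_subset_iff.2 hmaps)
    rw [card_image_of_injOn, card_piAntidiag_univ, card_piAntidiag_univ, card_cell,
      Fintype.card_fin, Nat.multichoose_eq, Nat.multichoose_eq,
      show n + 1 + (a + 1) * s - 1 = n + (a + 1) * s by omega,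
      show (a + 1) * s + 1 + n - 1 = (a + 1) * s + n by omega, add_comm n,
      Nat.choose_symm_add]
    intro y hy y' hy'
    simp only [mem_coe, mem_piAntidiag] at hy hy'
    exact cellCount_injOn n a s hy.1 hy'.1
  have hcard : #{y ∈ piAntidiag (univ : Finset (Fin (n + 1))) ((a + 1) * s) |
        G (residueCount (a + 1) y)} =
      #{N ∈ piAntidiag (univ : Finset (Cell a s)) n |
        G (fun v => ∑ b, N ⟨v, b⟩ + if v = 0 then 1 else 0)} := by
    rw [← himage, filter_image, card_image_of_injOn]
    · congr 1
      refine filter_congr fun y hy => ?_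
      rw [mem_piAntidiag] at hy
      rw [residueCount_eq hy.1]
    · intro y hy y' hy'
      simp only [mem_coe, mem_filter, mem_piAntidiag] at hy hy'
      exact cellCount_injOn n a s hy.1.1 hy'.1.1
  rw [hcard, card_eq_sum_card_fiberwise (f := fun N v => ∑ b, N ⟨v, b⟩)
    (t := piAntidiag (univ : Finset (Fin (a + 1))) n)]
  · refine sum_congr rfl fun g hg => ?_
    rw [filter_filter]
    split_ifs with hG
    · have := card_sigma_fiber (κ := fun v : Fin (a + 1) => Fin (s + if v = 0 then 1 else 0)) n g
        (mem_piAntidiag.1 hg).1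
      simp only [Fintype.card_fin] at this
      rw [← this]
      congr 1
      refine filter_congr fun N _ => ⟨fun h => h.2, fun h => ⟨?_, h⟩⟩
      subst h
      exact hG
    · rw [card_eq_zero, filter_eq_empty_iff]
      rintro N - ⟨h1, rfl⟩
      exact hG h1
  · intro N hN
    simp only [coe_filter, Set.mem_ofPred_eq, mem_piAntidiag] at hN
    simp only [mem_coe, mem_piAntidiag]
    refine ⟨?_, by simp⟩
    rw [← hN.1.1]
    exact (Fintype.sum_sigma _).symm

end PrefixSums

section Winding
open Fin (partialSum)

theorem partialSum_mod {n : ℕ} (a : ℕ) (y : Fin n → ℕ) (j : Fin (n + 1)) :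
    partialSum (fun i => y i % a) j % a = partialSum y j % a := by
  induction j using Fin.induction with
  | zero => simp
  | succ j ih => rw [Fin.partialSum_succ, Fin.partialSum_succ, Nat.add_mod, ih, Nat.mod_mod,
      ← Nat.add_mod]

theorem residueCount_mod {n : ℕ} (a : ℕ) (y : Fin n → ℕ) :
    residueCount a (fun i => y i % a) = residueCount a y := by
  ext v
  simp only [residueCount, partialSum_mod]

open Classical in
/-- The winding vectors of level `a * d` satisfying the fibre condition. -/
noncomputable def windingVectors (n a d : ℕ) : Finset (Fin n → ℕ) :=
  {w ∈ Fintype.piFinset fun _ => range a |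
    ∑ i, w i = a * d ∧ GapsFit 0 (List.ofFn (residueCount a w))}

open Classical in
theorem card_gapsFit_eq_sum (n a s : ℕ) (ha : 1 ≤ a) :
    #{y ∈ piAntidiag (univ : Finset (Fin n)) (a * s) |
        GapsFit 0 (List.ofFn (residueCount a y))} =
      ∑ p ∈ HasAntidiagonal.antidiagonal s, #(windingVectors n a p.1) * n.multichoose p.2 := by
  have hprod : ∀ p : ℕ × ℕ, #(windingVectors n a p.1) * n.multichoose p.2 =
      #(windingVectors n a p.1 ×ˢ piAntidiag (univ : Finset (Fin n)) p.2) := fun p => by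
    rw [card_product, card_piAntidiag_univ, Fintype.card_fin]
  simp only [hprod]
  rw [← card_sigma]
  have hdecomp : ∀ y : Fin n → ℕ, ∑ i, y i = ∑ i, y i % a + a * ∑ i, y i / a := fun y => by
    rw [mul_sum, ← sum_add_distrib]
    exact sum_congr rfl fun i _ => (Nat.mod_add_div _ _).symm
  refine card_nbij'
    (fun y => ⟨((∑ i, y i % a) / a, ∑ i, y i / a), (fun i => y i % a, fun i => y i / a)⟩)
    (fun x i => x.2.1 i + a * x.2.2 i) ?_ ?_ ?_ ?_
  · intro y hy
    simp only [coe_filter, mem_piAntidiag, Set.mem_ofPred_eq] at hy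
    simp only [coe_sigma, Set.mem_sigma_iff, mem_coe, HasAntidiagonal.mem_antidiagonal,
      mem_product, windingVectors, mem_filter, Fintype.mem_piFinset, mem_range, mem_piAntidiag,
      residueCount_mod, mem_univ, implies_true, and_true]
    have h1 := hdecomp y
    rw [hy.1.1] at h1
    have hdvd : a ∣ ∑ i, y i % a := (Nat.dvd_add_left (Dvd.intro _ rfl)).1 (h1 ▸ Dvd.intro _ rfl)
    have h2 := Nat.mul_div_cancel' hdvd
    refine ⟨?_, fun i => Nat.mod_lt _ ha, h2.symm, hy.2⟩
    rw [← h2, ← mul_add] at h1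
    exact (Nat.eq_of_mul_eq_mul_left ha h1).symm
  · rintro ⟨⟨d, e⟩, w, z⟩ hx
    simp only [coe_sigma, Set.mem_sigma_iff, mem_coe, HasAntidiagonal.mem_antidiagonal,
      mem_product, windingVectors, mem_filter, Fintype.mem_piFinset, mem_range,
      mem_piAntidiag] at hx
    obtain ⟨hde, ⟨hw, hsum, hgap⟩, hz, -⟩ := hx
    simp only [coe_filter, mem_piAntidiag, Set.mem_ofPred_eq]
    refine ⟨⟨?_, by simp⟩, ?_⟩
    · rw [sum_add_distrib, hsum, ← mul_sum, ← mul_add]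
      congr 1
      exact (congrArg (d + ·) hz).trans hde
    · rw [← residueCount_mod]
      simpa only [Nat.add_mul_mod_self_left, Nat.mod_eq_of_lt (hw _)] using hgap
  · intro y _
    ext i
    exact Nat.mod_add_div _ _
  · rintro ⟨⟨d, e⟩, w, z⟩ hx
    simp only [coe_sigma, Set.mem_sigma_iff, mem_coe, HasAntidiagonal.mem_antidiagonal,
      mem_product, windingVectors, mem_filter, Fintype.mem_piFinset, mem_range,
      mem_piAntidiag] at hx
    obtain ⟨hde, ⟨hw, hsum, hgap⟩, hz, -⟩ := hx
    have hz' : ∑ i, z i = e := hz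
    simp only [Nat.add_mul_mod_self_left, Nat.mod_eq_of_lt (hw _), hsum,
      Nat.mul_div_cancel_left _ ha, Nat.add_mul_div_left _ _ ha, Nat.div_eq_of_lt (hw _),
      zero_add, hz']

open Classical in
theorem one_sub_X_pow_mul_mk_card (n a : ℕ) (ha : 1 ≤ a) :
    (1 - PowerSeries.X : PowerSeries ℤ) ^ n * PowerSeries.mk (fun s =>
        (#{y ∈ piAntidiag (univ : Finset (Fin n)) (a * s) |
          GapsFit 0 (List.ofFn (residueCount a y))} : ℤ)) =
      PowerSeries.mk fun d => (#(windingVectors n a d) : ℤ) := by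
  have h : PowerSeries.mk (fun s => (#{y ∈ piAntidiag (univ : Finset (Fin n)) (a * s) |
        GapsFit 0 (List.ofFn (residueCount a y))} : ℤ)) =
      (PowerSeries.mk fun d => (#(windingVectors n a d) : ℤ)) * PowerSeries.mk 1 ^ n := by
    ext s
    rw [PowerSeries.coeff_mk, card_gapsFit_eq_sum n a s ha, PowerSeries.coeff_mul]
    push_cast
    refine sum_congr rfl fun p _ => ?_
    rw [PowerSeries.coeff_mk, coeff_mk_one_pow]
  rw [h, mul_left_comm, ← mul_pow, mul_comm (1 - _), PowerSeries.mk_one_mul_one_sub_eq_one,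
    one_pow, mul_one]

end Winding

section WindOfPositions
open Fin (partialSum)

theorem cyc_castSucc {n : ℕ} (j : Fin n) : cyc j.castSucc = j.succ := by
  ext
  simp only [cyc, Fin.val_castSucc, Fin.val_succ]
  exact Nat.mod_eq_of_lt (by omega)

theorem cyc_last (n : ℕ) : cyc (Fin.last n) = 0 := by
  ext
  simp [cyc]

/-- The vector of cyclic differences modulo `a` of a vector of positions. -/
def cyclicDiff {n : ℕ} (a : ℕ) (q : Fin n → ℕ) (i : Fin n) : ℕ :=
  (((q (cyc i) : ℤ) - (q i : ℤ)) % (a : ℤ)).toNat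

theorem cast_cyclicDiff {n a : ℕ} (ha : 1 ≤ a) (q : Fin n → ℕ) (i : Fin n) :
    (cyclicDiff a q i : ℤ) = ((q (cyc i) : ℤ) - (q i : ℤ)) % (a : ℤ) :=
  Int.toNat_of_nonneg (Int.emod_nonneg _ (by omega))

theorem cyclicDiff_lt {n a : ℕ} (ha : 1 ≤ a) (q : Fin n → ℕ) (i : Fin n) :
    cyclicDiff a q i < a := by
  zify
  rw [cast_cyclicDiff ha]
  exact Int.emod_lt_of_pos _ (by omega)

theorem partialSum_cyclicDiff_mod {n a : ℕ} (ha : 1 ≤ a) {q : Fin (n + 1) → ℕ}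
    (hq : ∀ i, q i < a) (h0 : q 0 = 0) (j : Fin (n + 1)) :
    partialSum (cyclicDiff a q) j.castSucc % a = q j := by
  induction j using Fin.induction with
  | zero => simp [h0]
  | succ j ih =>
    rw [Fin.castSucc_succ, Fin.partialSum_succ]
    zify at ih ⊢
    have hlt : (q j.succ : ℤ) % a = q j.succ :=
      Int.emod_eq_of_lt (by positivity) (by exact_mod_cast hq _)
    rw [cast_cyclicDiff ha, cyc_castSucc, Int.add_emod_emod, ← Int.emod_add_emod, ih,
      add_sub_cancel, hlt]

theorem cyclicDiff_partialSum_mod {n a d : ℕ} {w : Fin (n + 1) → ℕ}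
    (hw : ∀ i, w i < a) (hsum : ∑ i, w i = a * d) :
    cyclicDiff a (fun j => partialSum w j.castSucc % a) = w := by
  ext i
  zify
  have ha : 1 ≤ a := by have := hw 0; omega
  rw [cast_cyclicDiff ha]
  have hi := Fin.partialSum_succ w i
  have hmod : ((w i : ℤ)) % (a : ℤ) = w i :=
    Int.emod_eq_of_lt (by positivity) (by exact_mod_cast hw i)
  have : partialSum w (cyc i).castSucc % a = partialSum w i.succ % a := by
    induction i using Fin.lastCases with
    | last =>
      rw [cyc_last, Fin.succ_last, partialSum_last, hsum]
      simp
    | cast j => rw [cyc_castSucc, Fin.castSucc_succ]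
  rw [this, hi]
  push_cast
  rw [Int.emod_sub_emod, Int.sub_emod_emod, add_sub_cancel_left, hmod]

end WindOfPositions

section Positions

/-- The list of the blocks of `P`, each followed by one empty set less than its decoration. -/
def expand {n : ℕ} (P : List (Finset (Fin n) × ℕ)) : List (Finset (Fin n)) :=
  P.flatMap fun B => B.1 :: List.replicate (B.2 - 1) ∅

/-- The decorated list of the nonempty sets in a list, each decorated with the distance to the next
nonempty one. -/
def collapse {n : ℕ} : List (Finset (Fin n)) → List (Finset (Fin n) × ℕ)
  | [] => []
  | A :: t => if A = ∅ then collapse t else (A, 1 + (t.takeWhile (· = ∅)).length) :: collapse t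

variable {n : ℕ}

theorem expand_cons (B : Finset (Fin n) × ℕ) (P : List (Finset (Fin n) × ℕ)) :
    expand (B :: P) = B.1 :: (List.replicate (B.2 - 1) ∅ ++ expand P) := by
  simp [expand]

theorem length_expand {P : List (Finset (Fin n) × ℕ)} (hP : ∀ B ∈ P, 1 ≤ B.2) :
    (expand P).length = (P.map Prod.snd).sum := by
  induction P with
  | nil => simp [expand]
  | cons B P ih =>
    rw [List.forall_mem_cons] at hP
    simp only [expand_cons, List.length_cons, List.length_append, List.length_replicate,
      List.map_cons, List.sum_cons, ih hP.2]
    omega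

theorem gapsFit_replicate_zero_append (k m : ℕ) (L : List ℕ) :
    GapsFit k (List.replicate m 0 ++ L) ↔ m ≤ k ∧ GapsFit (k - m) L := by
  induction m generalizing k with
  | zero => simp
  | succ m ih =>
    simp only [List.replicate_succ, List.cons_append, GapsFit, ih, true_and]
    rw [Nat.sub_sub, Nat.add_comm 1 m]
    grind

theorem gapsFit_expand {P : List (Finset (Fin n) × ℕ)}
    (hP : ∀ B ∈ P, B.1.Nonempty ∧ 1 ≤ B.2) (k : ℕ) :
    GapsFit k ((expand P).map card) ↔ ∀ B ∈ P, B.2 < #B.1 := by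
  induction P generalizing k with
  | nil => simp [expand, GapsFit]
  | cons B P ih =>
    rw [List.forall_mem_cons] at hP
    have hB := hP.1.1.card_pos
    simp only [expand_cons, List.map_cons, List.map_append, List.map_replicate, card_empty,
      GapsFit, gapsFit_replicate_zero_append, ih hP.2, List.forall_mem_cons]
    have := hP.1.2
    constructor
    · rintro (⟨h, -⟩ | ⟨h1, h2, h3⟩)
      · omega
      · exact ⟨by omega, h3⟩
    · rintro ⟨h1, h2⟩
      exact Or.inr ⟨by omega, by omega, h2⟩

theorem posOf_cons (B : Finset (Fin n) × ℕ) (P : List (Finset (Fin n) × ℕ)) (x : Fin n) :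
    posOf (B :: P) x = if x ∈ B.1 then 0 else B.2 + posOf P x := by
  by_cases h : x ∈ B.1 <;> simp [posOf, h]

theorem mem_getD_expand {P : List (Finset (Fin n) × ℕ)} (hP : ∀ B ∈ P, 1 ≤ B.2)
    (hdisj : P.Pairwise fun B C => Disjoint B.1 C.1) (x : Fin n) (i : ℕ) :
    x ∈ (expand P).getD i ∅ ↔ (∃ B ∈ P, x ∈ B.1) ∧ posOf P x = i := by
  induction P generalizing i with
  | nil => simp [expand]
  | cons B P ih =>
    rw [List.forall_mem_cons] at hP
    rw [List.pairwise_cons] at hdisj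
    rw [expand_cons, posOf_cons]
    have hnot : x ∈ B.1 → ¬ ∃ C ∈ P, x ∈ C.1 := fun hx ⟨C, hC, hxC⟩ =>
      disjoint_left.mp (hdisj.1 C hC) hx hxC
    have hmem : (∃ C ∈ B :: P, x ∈ C.1) ↔ x ∈ B.1 ∨ ∃ C ∈ P, x ∈ C.1 := by simp
    rw [hmem]
    cases i with
    | zero =>
      rw [List.getD_cons_zero]
      split_ifs with h
      · simp [h]
      · have := hP.1; simp only [h, false_iff]; omega
    | succ i =>
      rw [List.getD_cons_succ]
      by_cases hi : i < B.2 - 1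
      · rw [List.getD_append _ _ _ _ (by simpa using hi)]
        simp only [List.getD_replicate _ hi, notMem_empty, false_iff]
        rintro ⟨-, h⟩
        split_ifs at h
        omega
      · rw [List.getD_append_right _ _ _ _ (by simpa using hi), ih hP.2 hdisj.2]
        have := hP.1
        simp only [List.length_replicate]
        split_ifs with h
        · simp [hnot h]
        · simp only [h, false_or]
          refine and_congr_right fun _ => ?_
          omega

theorem collapse_replicate_append (m : ℕ) (L : List (Finset (Fin n))) :
    collapse (List.replicate m ∅ ++ L) = collapse L := by
  induction m with
  | zero => simp
  | succ m ih => simp [List.replicate_succ, collapse, ih]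

theorem collapse_expand {P : List (Finset (Fin n) × ℕ)}
    (hP : ∀ B ∈ P, B.1.Nonempty ∧ 1 ≤ B.2) : collapse (expand P) = P := by
  induction P with
  | nil => simp [expand, collapse]
  | cons B P ih =>
    rw [List.forall_mem_cons] at hP
    have htake : (expand P).takeWhile (· = ∅) = [] := by
      cases P with
      | nil => simp [expand]
      | cons C P => simp [expand_cons, (hP.2 C (by simp)).1.ne_empty]
    have hB := hP.1.2
    rw [expand_cons, collapse, if_neg hP.1.1.ne_empty, collapse_replicate_append, ih hP.2,
      List.takeWhile_append_of_pos (by simp), htake, List.append_nil, List.length_replicate,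
      Nat.add_sub_cancel' hB]

theorem replicate_append_expand_collapse (L : List (Finset (Fin n))) :
    List.replicate (L.takeWhile (· = ∅)).length ∅ ++ expand (collapse L) = L := by
  induction L with
  | nil => simp [expand, collapse]
  | cons A t ih =>
    by_cases hA : A = ∅
    · simp [hA, collapse, List.replicate_succ, ih]
    · simp [hA, collapse, expand_cons, ih]

theorem collapse_pos (L : List (Finset (Fin n))) :
    ∀ B ∈ collapse L, B.1.Nonempty ∧ 1 ≤ B.2 := by
  induction L with
  | nil => simp [collapse]
  | cons A t ih =>
    rw [collapse]
    split_ifs with hA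
    · exact ih
    · rw [List.forall_mem_cons]
      exact ⟨⟨nonempty_iff_ne_empty.mpr hA, by simp⟩, ih⟩

theorem map_fst_collapse (L : List (Finset (Fin n))) :
    (collapse L).map Prod.fst = L.filter (· ≠ ∅) := by
  induction L with
  | nil => simp [collapse]
  | cons A t ih =>
    rw [collapse]
    split_ifs with hA <;> simp [hA] <;> simpa using ih

theorem expand_eq_ofFn {a : ℕ} {P : List (Finset (Fin n) × ℕ)} (hP : IsDOSP n a P) :
    expand P = List.ofFn fun v : Fin a => ({j | posOf P j = v} : Finset (Fin n)) := by
  obtain ⟨hpos, hdisj, hcover, hsum⟩ := hP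
  have hlen := (length_expand fun B hB => (hpos B hB).2).trans hsum
  refine List.ext_getElem (by simpa using hlen) fun i h1 h2 => ?_
  ext x
  have h := mem_getD_expand (fun B hB => (hpos B hB).2) hdisj x i
  rw [List.getD_eq_getElem _ _ h1] at h
  simp [h, hcover x]

theorem posOf_lt {a : ℕ} {P : List (Finset (Fin n) × ℕ)} (hP : IsDOSP n a P) (x : Fin n) :
    posOf P x < a := by
  obtain ⟨hpos, hdisj, hcover, hsum⟩ := hP
  rw [← (length_expand fun B hB => (hpos B hB).2).trans hsum]
  by_contra! h
  have hx := (mem_getD_expand (fun B hB => (hpos B hB).2) hdisj x _).mpr ⟨hcover x, rfl⟩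
  rw [List.getD_eq_default _ _ h] at hx
  exact notMem_empty _ hx

theorem posOf_injOn {a : ℕ} {P Q : List (Finset (Fin n) × ℕ)} (hP : IsDOSP n a P)
    (hQ : IsDOSP n a Q) (h : posOf P = posOf Q) : P = Q := by
  rw [← collapse_expand hP.1, ← collapse_expand hQ.1, expand_eq_ofFn hP, expand_eq_ofFn hQ, h]

theorem gapsFit_posOf {a : ℕ} {P : List (Finset (Fin n) × ℕ)} (hP : IsDOSP n a P) :
    GapsFit 0 (List.ofFn fun v : Fin a => #{j | posOf P j = v}) ↔ ∀ B ∈ P, B.2 < #B.1 := by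
  rw [← gapsFit_expand hP.1 0, expand_eq_ofFn hP, List.map_ofFn]
  rfl

theorem firstBlock_iff {a : ℕ} {P : List (Finset (Fin (n + 1)) × ℕ)} (hP : IsDOSP (n + 1) a P) :
    FirstBlock P ↔ posOf P 0 = 0 := by
  have hF : FirstBlock P ↔ (0 : Fin (n + 1)) ∈ P.headI.1 :=
    ⟨fun h => h 0 rfl, fun h x hx => by rwa [show x = 0 from Fin.ext hx]⟩
  obtain ⟨hpos, -, hcover, -⟩ := hP
  rw [hF]
  cases P with
  | nil => simpa using hcover 0
  | cons B P =>
    have := (hpos B (by simp)).2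
    rw [posOf_cons, List.headI_cons]
    split_ifs with h <;> simp [h]
    omega

theorem exists_posOf_eq {a : ℕ} {q : Fin (n + 1) → ℕ} (hq : ∀ i, q i < a) (h0 : q 0 = 0) :
    ∃ P, IsDOSP (n + 1) a P ∧ posOf P = q := by
  obtain ⟨a, rfl⟩ : ∃ b, a = b + 1 := ⟨a - 1, by have := hq 0; omega⟩
  set L : List (Finset (Fin (n + 1))) := List.ofFn fun v : Fin (a + 1) => ({j | q j = v} : Finset _)
    with hL
  have hexp : expand (collapse L) = L := by
    have h := replicate_append_expand_collapse L
    have hne : ({j | q j = (0 : Fin (a + 1))} : Finset (Fin (n + 1))) ≠ ∅ :=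
      nonempty_iff_ne_empty.mp ⟨0, mem_filter.mpr ⟨mem_univ _, h0⟩⟩
    have htake : L.takeWhile (· = ∅) = [] := by
      rw [hL, List.ofFn_succ, List.takeWhile_cons_of_neg (by simpa only [decide_eq_true_eq])]
    simpa [htake] using h
  have hpos := collapse_pos L
  have hdisj : (collapse L).Pairwise fun B C => Disjoint B.1 C.1 := by
    rw [← List.pairwise_map (f := Prod.fst) (R := Disjoint), map_fst_collapse]
    refine List.Pairwise.filter _ ?_
    rw [hL, List.pairwise_ofFn]
    intro i j hij
    rw [disjoint_left]
    intro x hx hx'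
    simp only [mem_filter, mem_univ, true_and] at hx hx'
    exact hij.ne (Fin.ext (hx.symm.trans hx'))
  have hmem : ∀ x, (∃ B ∈ collapse L, x ∈ B.1) ∧ posOf (collapse L) x = q x := fun x => by
    rw [← mem_getD_expand (fun B hB => (hpos B hB).2) hdisj, hexp,
      List.getD_eq_getElem _ _ (by simpa [hL] using hq x)]
    simp only [hL, List.getElem_ofFn, mem_filter, mem_univ, true_and]
  refine ⟨collapse L, ⟨hpos, hdisj, fun x => (hmem x).1, ?_⟩, funext fun x => (hmem x).2⟩
  rw [← length_expand fun B hB => (hpos B hB).2, hexp, hL, List.length_ofFn]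

theorem card_hypersimplicial (n a d : ℕ) (ha : 1 ≤ a) :
    Nat.card {P : List (Finset (Fin (n + 1)) × ℕ) //
      IsDOSP (n + 1) a P ∧ (∀ B ∈ P, B.2 < #B.1) ∧ FirstBlock P ∧ level a P = a * d} =
      #(windingVectors (n + 1) a d) := by
  have hres : ∀ {P : List (Finset (Fin (n + 1)) × ℕ)}, IsDOSP (n + 1) a P → posOf P 0 = 0 →
      ∀ j, Fin.partialSum (cyclicDiff a (posOf P)) j.castSucc % a = posOf P j :=
    fun hP h0 j => partialSum_cyclicDiff_mod ha (posOf_lt hP) h0 j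
  have hgap : ∀ {P : List (Finset (Fin (n + 1)) × ℕ)}, IsDOSP (n + 1) a P → posOf P 0 = 0 →
      (GapsFit 0 (List.ofFn (residueCount a (cyclicDiff a (posOf P)))) ↔
        ∀ B ∈ P, B.2 < #B.1) := fun {P} hP h0 => by
    rw [← gapsFit_posOf hP]
    have : residueCount a (cyclicDiff a (posOf P)) = fun v : Fin a => #{j | posOf P j = v} := by
      ext v
      simp only [residueCount, hres hP h0]
    rw [this]
  have hmem : ∀ w, w ∈ windingVectors (n + 1) a d ↔ (∀ i, w i < a) ∧ ∑ i, w i = a * d ∧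
      GapsFit 0 (List.ofFn (residueCount a w)) := fun w => by
    simp [windingVectors, Fintype.mem_piFinset]
  rw [← Nat.card_eq_finsetCard]
  refine Nat.card_congr (Equiv.ofBijective (fun P => ⟨cyclicDiff a (posOf P.1), (hmem _).mpr
    ⟨cyclicDiff_lt ha _, P.2.2.2.2,
      (hgap P.2.1 ((firstBlock_iff P.2.1).mp P.2.2.2.1)).mpr P.2.2.1⟩⟩) ⟨?_, ?_⟩)
  · rintro ⟨P, hP, _, hPf, _⟩ ⟨Q, hQ, _, hQf, _⟩ h
    rw [firstBlock_iff hP] at hPf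
    rw [firstBlock_iff hQ] at hQf
    have h' : cyclicDiff a (posOf P) = cyclicDiff a (posOf Q) := congrArg Subtype.val h
    refine Subtype.ext (posOf_injOn hP hQ (funext fun j => ?_))
    rw [← hres hP hPf, ← hres hQ hQf, h']
  · rintro ⟨w, hw⟩
    obtain ⟨hlt, hsum, hfit⟩ := (hmem w).mp hw
    obtain ⟨P, hP, hpos⟩ := exists_posOf_eq
      (q := fun j => Fin.partialSum w j.castSucc % a) (fun i => Nat.mod_lt _ ha) (by simp)
    have hdiff : cyclicDiff a (posOf P) = w := by rw [hpos, cyclicDiff_partialSum_mod hlt hsum]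
    have h0 : posOf P 0 = 0 := by simp [hpos]
    refine ⟨⟨P, hP, (hgap hP h0).mp (by rwa [hdiff]), (firstBlock_iff hP).mpr h0, ?_⟩,
      Subtype.ext hdiff⟩
    rw [← hsum, ← hdiff]
    rfl

end Positions

section LatticePoints

theorem card_lattice_points (n a s : ℕ) :
    Nat.card {y : Fin n → ℤ //
      (∀ i, 0 ≤ y i ∧ y i ≤ (s : ℤ)) ∧ ∑ i, y i = (a : ℤ) * (s : ℤ)} =
      #{y ∈ Fintype.piFinset (fun _ : Fin n => range (s + 1)) | ∑ i, y i = a * s} := by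
  rw [← Nat.card_eq_finsetCard]
  have hcast : ∀ y : Fin n → ℕ,
      y ∈ ({y ∈ Fintype.piFinset (fun _ : Fin n => range (s + 1)) | ∑ i, y i = a * s} : Finset _) →
        (∀ i, 0 ≤ (y i : ℤ) ∧ (y i : ℤ) ≤ (s : ℤ)) ∧ ∑ i, (y i : ℤ) = (a : ℤ) * (s : ℤ) :=
    fun y hy => by
      simp only [mem_filter, Fintype.mem_piFinset, mem_range] at hy
      exact ⟨fun i => by have := hy.1 i; omega, by exact_mod_cast hy.2⟩
  refine (Nat.card_congr (Equiv.ofBijective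
    (fun y => ⟨fun i => (y.1 i : ℤ), hcast y.1 y.2⟩) ⟨?_, ?_⟩)).symm
  · intro y z h
    refine Subtype.ext (funext fun i => ?_)
    exact Int.ofNat_inj.mp (congrFun (congrArg Subtype.val h) i)
  · rintro ⟨y, hy, hsum⟩
    have hnat : ∀ i, ((y i).toNat : ℤ) = y i := fun i => Int.toNat_of_nonneg (hy i).1
    refine ⟨⟨fun i => (y i).toNat, ?_⟩, Subtype.ext (funext hnat)⟩
    simp only [mem_filter, Fintype.mem_piFinset, mem_range]
    refine ⟨fun i => by have := hy i; omega, ?_⟩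
    zify
    simp only [hnat, hsum]

open Classical in
theorem card_gapsFit_eq_card_box (n s a : ℕ) (ha : 1 ≤ a) (han : a < n) :
    (#{y ∈ piAntidiag (univ : Finset (Fin n)) (a * s) |
        GapsFit 0 (List.ofFn (residueCount a y))} : ℤ) =
      #{y ∈ Fintype.piFinset (fun _ : Fin n => range (s + 1)) | ∑ i, y i = a * s} := by
  obtain ⟨a, rfl⟩ := Nat.exists_eq_add_of_le' ha
  obtain ⟨n, rfl⟩ : ∃ m, n = m + 1 := ⟨n - 1, by omega⟩
  rw [card_residueCount n a s fun f => GapsFit 0 (List.ofFn f), card_box _ _ _ han,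
    ← coeff_coeff_firstBlockSeries_mul s (a + 1) (n + 1) ha han _ (one_sub_blockSeries_mul s),
    ← sum_gapsFit_eq]
  push_cast
  rfl

end LatticePoints

end Hypersimplex

/-- Conjecture 1: for `1 ≤ a < n`, in `ℤ[[x]]`,
`(1−x)^n · Σ_s E(s) x^s = Σ_d m_d x^d`, where `E(s)` counts lattice points of the
`s`-th dilate of the hypersimplex `B_{a,n−a}` and `m_d` counts hypersimplicial
ordered set partitions of type `(a,n)` with `1 ∈ L₁` and winding number `d`. -/
theorem hstar_hypersimplex (n a : ℕ) (ha : 1 ≤ a) (han : a < n) :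
    (1 - PowerSeries.X : PowerSeries ℤ) ^ n *
        PowerSeries.mk (fun s =>
          (Nat.card {y : Fin n → ℤ //
              (∀ i, 0 ≤ y i ∧ y i ≤ (s : ℤ)) ∧ ∑ i, y i = (a : ℤ) * (s : ℤ)} : ℤ))
      = PowerSeries.mk (fun d =>
          (Nat.card {P : List (Finset (Fin n) × ℕ) //
              IsDOSP n a P ∧ (∀ B ∈ P, B.2 < B.1.card) ∧ FirstBlock P ∧
                level a P = a * d} : ℤ)) := by
  obtain ⟨n, rfl⟩ : ∃ m, n = m + 1 := ⟨n - 1, by omega⟩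
  simp only [card_lattice_points, card_hypersimplicial n a _ ha,
    ← card_gapsFit_eq_card_box _ _ _ ha han]
  exact one_sub_X_pow_mul_mk_card (n + 1) a ha
end

section
/- In the ring of formal power series ℤ[[x]], (1−x)^5 · Σ_{s≥0} E(s) x^s = 1 + 5x + 5x², where E(s) = #{ y ∈ ℤ^5 : 0 ≤ y_i ≤ s, y₁+⋯+y₅ = 2s }; that is, the Ehrhart h*-vector of the hypersimplex B_{2,3} is (1,5,5). -/
open Finset in
theorem card_piAntidiag_univ_nat {ι : Type*} [Fintype ι] [DecidableEq ι] (n : ℕ) :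
    #(piAntidiag (univ : Finset ι) n) = (Fintype.card ι + n - 1).choose n := by
  rw [← map_sym_eq_piAntidiag, card_map, sym_univ, card_univ, Sym.card_sym_eq_choose]

open Finset in
theorem card_filter_le_piAntidiag_univ {ι : Type*} [Fintype ι] [DecidableEq ι] (i : ι) (r m : ℕ) :
    #{f ∈ piAntidiag (univ : Finset ι) (r + m) | m ≤ f i} = #(piAntidiag (univ : Finset ι) r) := by
  symm
  refine card_bij (fun f _ => f + Pi.single i m) ?_ (fun f _ g _ h => add_right_cancel h) ?_
  · intro f hf
    simp_all [sum_add_distrib]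
  · intro g hg
    simp only [mem_filter, mem_piAntidiag, mem_univ, implies_true, and_true] at hg
    have hle : Pi.single i m ≤ g := by
      intro j
      rcases eq_or_ne j i with rfl | hj
      · simpa using hg.2
      · simp [hj]
    have hsub : g - Pi.single i m + Pi.single i m = g := tsub_add_cancel_of_le hle
    refine ⟨g - Pi.single i m, ?_, hsub⟩
    have hsum : ∑ j, (g - Pi.single i m + Pi.single i m : ι → ℕ) j = r + m := by rw [hsub, hg.1]
    simpa [sum_add_distrib, -Pi.sub_apply] using hsum

open Finset in
/-- Since `r < m`, a tuple of total `r + m` has at most one entry that is at least `m`. -/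
theorem card_filter_lt_piAntidiag_univ_add {ι : Type*} [Fintype ι] [DecidableEq ι] {r m : ℕ}
    (hrm : r < m) :
    #{f ∈ piAntidiag (univ : Finset ι) (r + m) | ∀ i, f i < m} +
        Fintype.card ι * #(piAntidiag (univ : Finset ι) r) =
      #(piAntidiag (univ : Finset ι) (r + m)) := by
  rw [← card_filter_add_card_filter_not (s := piAntidiag (univ : Finset ι) (r + m))
    (fun f => ∀ i, f i < m)]
  congr 1
  have hunion : {f ∈ piAntidiag (univ : Finset ι) (r + m) | ¬ ∀ i, f i < m} =
      univ.biUnion fun i => {f ∈ piAntidiag (univ : Finset ι) (r + m) | m ≤ f i} := by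
    ext f
    simp
  rw [hunion, card_biUnion]
  · simp [card_filter_le_piAntidiag_univ]
  · intro i _ j _ hij
    rw [Function.onFun, disjoint_left]
    intro f hi hj
    simp only [mem_filter, mem_piAntidiag, mem_univ, implies_true, and_true] at hi hj
    have hpair : f i + f j ≤ univ.sum f := by
      rw [← sum_pair hij]
      exact sum_le_sum_of_subset (subset_univ _)
    omega

open Finset in
theorem natCard_int_box_eq_card_piAntidiag {ι : Type*} [Fintype ι] [DecidableEq ι] (s n : ℕ) :
    Nat.card {y : ι → ℤ // (∀ i, 0 ≤ y i ∧ y i ≤ (s : ℤ)) ∧ ∑ i, y i = (n : ℤ)} =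
      #{f ∈ piAntidiag (univ : Finset ι) n | ∀ i, f i < s + 1} := by
  rw [← Nat.card_eq_finsetCard]
  refine Nat.card_congr
    { toFun := fun y => ⟨fun i => (y.1 i).toNat, ?_⟩
      invFun := fun f => ⟨fun i => (f.1 i : ℤ), ?_⟩
      left_inv := fun y => Subtype.ext (funext fun i => Int.toNat_of_nonneg (y.2.1 i).1)
      right_inv := fun f => Subtype.ext (funext fun i => Int.toNat_natCast _) }
  · obtain ⟨y, hy, hsum⟩ := y
    simp only [mem_filter, mem_piAntidiag, mem_univ, implies_true, and_true]
    refine ⟨?_, fun i => by have := hy i; omega⟩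
    zify
    rw [← hsum]
    exact sum_congr rfl fun i _ => Int.toNat_of_nonneg (hy i).1
  · obtain ⟨f, hf⟩ := f
    simp only [mem_filter, mem_piAntidiag, mem_univ, implies_true, and_true] at hf
    refine ⟨fun i => by have := hf.2 i; dsimp only; omega, ?_⟩
    dsimp only
    exact_mod_cast hf.1

theorem factorial_four_mul_choose_add_three (n : ℕ) :
    24 * (n + 3).choose 4 = n * (n + 1) * (n + 2) * (n + 3) := by
  have h := Nat.descFactorial_eq_factorial_mul_choose (n + 3) 4
  simp only [Nat.descFactorial, Nat.factorial] at h
  rw [show n + 3 - 3 = n by omega, show n + 3 - 2 = n + 1 by omega,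
    show n + 3 - 1 = n + 2 by omega, Nat.sub_zero] at h
  norm_num at h
  rw [← h]
  ring

theorem natCard_hypersimplex_dilate (s : ℕ) :
    Nat.card {y : Fin 5 → ℤ // (∀ i, 0 ≤ y i ∧ y i ≤ (s : ℤ)) ∧ ∑ i, y i = 2 * (s : ℤ)} =
      (s + 4).choose 4 + 5 * (s + 3).choose 4 + 5 * (s + 2).choose 4 := by
  have hcast : (2 * (s : ℤ)) = ((2 * s : ℕ) : ℤ) := by push_cast; rfl
  rw [hcast, natCard_int_box_eq_card_piAntidiag]
  cases s with
  | zero => simp [Finset.filter_singleton, Nat.choose]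
  | succ t =>
    have h := card_filter_lt_piAntidiag_univ_add (ι := Fin 5) (show t < t + 1 + 1 by omega)
    rw [show t + (t + 1 + 1) = 2 * (t + 1) by ring] at h
    simp only [card_piAntidiag_univ_nat, Fintype.card_fin] at h
    rw [show 5 + t - 1 = t + 4 by omega, show 5 + 2 * (t + 1) - 1 = 2 * (t + 1) + 4 by omega,
      Nat.choose_symm_add, Nat.choose_symm_add] at h
    have h0 := factorial_four_mul_choose_add_three t
    have h1 := factorial_four_mul_choose_add_three (t + 1)
    have h2 := factorial_four_mul_choose_add_three (t + 2)
    have h3 := factorial_four_mul_choose_add_three (2 * t + 3)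
    ring_nf at h h0 h1 h2 h3 ⊢
    omega

/-- in `ℤ[[x]]`, `(1−x)^5 · Σ_s E(s) x^s = 1 + 5x + 5x²`, where
`E(s)` counts lattice points of the `s`-th dilate of the hypersimplex `B_{2,3}`;
i.e. the Ehrhart `h*`-vector of `B_{2,3}` is `(1,5,5)`. -/
theorem hstar_B23 :
    (1 - PowerSeries.X : PowerSeries ℤ) ^ 5 *
        PowerSeries.mk (fun s =>
          (Nat.card {y : Fin 5 → ℤ //
              (∀ i, 0 ≤ y i ∧ y i ≤ (s : ℤ)) ∧ ∑ i, y i = 2 * (s : ℤ)} : ℤ))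
      = 1 + 5 * PowerSeries.X + 5 * PowerSeries.X ^ 2 := by
  have hinv := PowerSeries.mk_add_choose_mul_one_sub_pow_eq_one ℤ 4
  have hseries : PowerSeries.mk (fun s =>
      (Nat.card {y : Fin 5 → ℤ //
        (∀ i, 0 ≤ y i ∧ y i ≤ (s : ℤ)) ∧ ∑ i, y i = 2 * (s : ℤ)} : ℤ)) =
      PowerSeries.mk (fun n => ((4 + n).choose 4 : ℤ)) *
        (1 + 5 * PowerSeries.X + 5 * PowerSeries.X ^ 2) := by
    ext s
    simp only [natCard_hypersimplex_dilate]
    rw [show ∀ p : PowerSeries ℤ, p * (1 + 5 * PowerSeries.X + 5 * PowerSeries.X ^ 2) =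
      p + PowerSeries.C 5 * (p * PowerSeries.X) + PowerSeries.C 5 * (p * PowerSeries.X ^ 2) from
      fun p => by rw [show (PowerSeries.C (5 : ℤ)) = 5 from map_ofNat _ 5]; ring]
    simp only [map_add, PowerSeries.coeff_C_mul, PowerSeries.coeff_mul_X_pow', PowerSeries.coeff_mk]
    rcases s with _ | _ | t
    · simp [Nat.choose]
    · simp [Nat.choose, PowerSeries.coeff_succ_mul_X]
    · simp [PowerSeries.coeff_succ_mul_X, add_comm 4, add_assoc]
  rw [hseries, ← mul_assoc, mul_comm (_ ^ 5), hinv, one_mul]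
end
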